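/- arXiv:2003.13857 — 3 statements merged into one kernel-verified Lean document; each statement's English description precedes it below -/
import Mathlib

section
/- Let n ≥ 2 and let Y be an unbounded closed subset of ℝ^{n+1}. For every c ∈ ℝ and ψ ∈ 𝔜₀(Y), one has (1/4)(|c| + ‖ψ‖_𝔜) ≤ ‖c·𝟙 + ψ‖_𝔜 ≤ |c| + ‖ψ‖_𝔜. -/
/- Function spaces 𝔚, 𝔛, 𝔜′, 𝔜₀, 𝔜 on `Y × 𝕊ⁿ` from Bernstein–Wang,
"A mountain-pass theorem for asymptotically conical self-expanders". -/

noncomputable section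

open Set Metric Real Filter
open scoped RealInnerProductSpace

/-- `ℝ^{n+1}` as a Euclidean space. -/
abbrev Euc (n : ℕ) : Type := EuclideanSpace ℝ (Fin (n + 1))

/-- The unit sphere `𝕊ⁿ ⊆ ℝ^{n+1}`. -/
def Sph (n : ℕ) : Set (Euc n) := Metric.sphere (0 : Euc n) 1

/-- The set `Y × 𝕊ⁿ` inside `ℝ^{n+1} × ℝ^{n+1}`. -/
def pts {n : ℕ} (Y : Set (Euc n)) : Set (Euc n × Euc n) := Y ×ˢ Sph n

/-- The weight `(1+|p|)^{n+1} e^{|p|²/4}` appearing in the 𝔚-norm. -/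
def wWeight (n : ℕ) (p : Euc n) : ℝ := (1 + ‖p‖) ^ (n + 1) * Real.exp (‖p‖ ^ 2 / 4)

/-- The 𝔚-norm `sup (1+|p|)^{n+1} e^{|p|²/4} |ψ|` over `Y × 𝕊ⁿ`. -/
def WNorm {n : ℕ} (Y : Set (Euc n)) (ψ : Euc n × Euc n → ℝ) : ℝ :=
  sSup ((fun x => wWeight n x.1 * |ψ x|) '' pts Y)

/-- Membership in the space 𝔚(Y) of rapidly decaying continuous functions. -/
def memW {n : ℕ} (Y : Set (Euc n)) (ψ : Euc n × Euc n → ℝ) : Prop :=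
  ContinuousOn ψ (pts Y) ∧ ∃ M : ℝ, ∀ x ∈ pts Y, wWeight n x.1 * |ψ x| ≤ M

/-- Supremum norm over `Y × 𝕊ⁿ`. -/
def nsup {n : ℕ} {F : Type*} [NormedAddCommGroup F] (Y : Set (Euc n))
    (f : Euc n × Euc n → F) : ℝ :=
  sSup ((fun x => ‖f x‖) '' pts Y)

/-- The set of Lipschitz constants of `f` on `Y × 𝕊ⁿ` (with the metric induced from
`ℝ^{n+1} × ℝ^{n+1}`). -/
def lipSet {n : ℕ} {F : Type*} [NormedAddCommGroup F] (Y : Set (Euc n))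
    (f : Euc n × Euc n → F) : Set ℝ :=
  {K : ℝ | 0 ≤ K ∧ ∀ x ∈ pts Y, ∀ y ∈ pts Y, ‖f x - f y‖ ≤ K * dist x y}

/-- The Lipschitz norm `‖f‖_{Lip}`: sup norm plus best Lipschitz constant. -/
def LipNorm {n : ℕ} {F : Type*} [NormedAddCommGroup F] (Y : Set (Euc n))
    (f : Euc n × Euc n → F) : ℝ :=
  nsup Y f + sInf (lipSet Y f)

/-- `f` is bounded and Lipschitz on `Y × 𝕊ⁿ`. -/
def IsBddLip {n : ℕ} {F : Type*} [NormedAddCommGroup F] (Y : Set (Euc n))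
    (f : Euc n × Euc n → F) : Prop :=
  (∃ M : ℝ, ∀ x ∈ pts Y, ‖f x‖ ≤ M) ∧ (lipSet Y f).Nonempty

/-- `g` is the spherical gradient `∇_{𝕊ⁿ} ψ` on `Y × 𝕊ⁿ`: at each `(p,v) ∈ Y × 𝕊ⁿ`,
`g(p,v)` is orthogonal to `v` and is the gradient of `ψ(p,·)` at `v` along the sphere. -/
def IsSphereGrad {n : ℕ} (Y : Set (Euc n)) (ψ : Euc n × Euc n → ℝ)
    (g : Euc n × Euc n → Euc n) : Prop :=
  ∀ x ∈ pts Y,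
    ⟪g x, x.2⟫ = 0 ∧
    HasFDerivWithinAt (fun v => ψ (x.1, v)) (innerSL ℝ (g x)) (Sph n) x.2

/-- The weighted gradient supremum `sup (1+|p|)|∇_{𝕊ⁿ}ψ|`. -/
def gradWsup {n : ℕ} (Y : Set (Euc n)) (g : Euc n × Euc n → Euc n) : ℝ :=
  sSup ((fun x => (1 + ‖x.1‖) * ‖g x‖) '' pts Y)

/-- Membership in the space 𝔛(Y). -/
def memX {n : ℕ} (Y : Set (Euc n)) (ψ : Euc n × Euc n → ℝ) : Prop :=
  IsBddLip Y ψ ∧ ∃ g : Euc n × Euc n → Euc n, IsSphereGrad Y ψ g ∧ IsBddLip Y g ∧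
    ∃ M : ℝ, ∀ x ∈ pts Y, (1 + ‖x.1‖) * ‖g x‖ ≤ M

/-- The 𝔛-norm `‖ψ‖_𝔛 = ‖ψ‖_{Lip} + ‖∇_{𝕊ⁿ}ψ‖_{Lip} + sup (1+|p|)|∇_{𝕊ⁿ}ψ|`
(as an infimum over representatives of the spherical gradient). -/
def XNorm {n : ℕ} (Y : Set (Euc n)) (ψ : Euc n × Euc n → ℝ) : ℝ :=
  sInf {r : ℝ | ∃ g : Euc n × Euc n → Euc n, IsSphereGrad Y ψ g ∧
    r = LipNorm Y ψ + LipNorm Y g + gradWsup Y g}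

/-- Membership in `𝔜′(Y) = 𝔛(Y) + 𝔚(Y)` (equality of functions on `Y × 𝕊ⁿ`). -/
def memYp {n : ℕ} (Y : Set (Euc n)) (ψ : Euc n × Euc n → ℝ) : Prop :=
  ∃ ζ ξ : Euc n × Euc n → ℝ, memX Y ζ ∧ memW Y ξ ∧ ∀ x ∈ pts Y, ψ x = ζ x + ξ x

/-- The 𝔜-norm `‖ψ‖_𝔜 = inf {‖ζ‖_𝔛 + ‖ξ‖_𝔚 : ψ = ζ + ξ}`. -/
def YNorm {n : ℕ} (Y : Set (Euc n)) (ψ : Euc n × Euc n → ℝ) : ℝ :=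
  sInf {r : ℝ | ∃ ζ ξ : Euc n × Euc n → ℝ, memX Y ζ ∧ memW Y ξ ∧
    (∀ x ∈ pts Y, ψ x = ζ x + ξ x) ∧ r = XNorm Y ζ + WNorm Y ξ}

/-- Continuous compactly supported functions on `Y × 𝕊ⁿ`. -/
def memCc {n : ℕ} (Y : Set (Euc n)) (φ : Euc n × Euc n → ℝ) : Prop :=
  ContinuousOn φ (pts Y) ∧
    ∃ K : Set (Euc n × Euc n), IsCompact K ∧ ∀ x ∈ pts Y, x ∉ K → φ x = 0

/-- Membership in `𝔜₀(Y)`: the closure of `C⁰_c(Y × 𝕊ⁿ)` in `𝔜′(Y)`. -/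
def memY0 {n : ℕ} (Y : Set (Euc n)) (ψ : Euc n × Euc n → ℝ) : Prop :=
  memYp Y ψ ∧ ∀ ε : ℝ, 0 < ε → ∃ φ, memCc Y φ ∧ YNorm Y (fun x => ψ x - φ x) < ε

/-- Membership in `𝔜(Y) = ℝ·𝟙 ⊕ 𝔜₀(Y)`. -/
def memY {n : ℕ} (Y : Set (Euc n)) (ψ : Euc n × Euc n → ℝ) : Prop :=
  ∃ (c : ℝ) (φ : Euc n × Euc n → ℝ), memY0 Y φ ∧ ∀ x ∈ pts Y, ψ x = c + φ x

theorem aux_nsup_nonneg {n : ℕ} {F : Type*} [NormedAddCommGroup F] (Y : Set (Euc n))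
    (f : Euc n × Euc n → F) : 0 ≤ nsup Y f := by
  apply Real.sSup_nonneg
  rintro _ ⟨x, _, rfl⟩
  exact norm_nonneg _

theorem aux_lip_nonneg {n : ℕ} {F : Type*} [NormedAddCommGroup F] (Y : Set (Euc n))
    (f : Euc n × Euc n → F) : 0 ≤ sInf (lipSet Y f) :=
  Real.sInf_nonneg fun _ hK => hK.1

theorem aux_LipNorm_nonneg {n : ℕ} {F : Type*} [NormedAddCommGroup F] (Y : Set (Euc n))
    (f : Euc n × Euc n → F) : 0 ≤ LipNorm Y f :=
  add_nonneg (aux_nsup_nonneg Y f) (aux_lip_nonneg Y f)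

theorem aux_gradWsup_nonneg {n : ℕ} (Y : Set (Euc n)) (g : Euc n × Euc n → Euc n) :
    0 ≤ gradWsup Y g := by
  apply Real.sSup_nonneg
  rintro _ ⟨x, _, rfl⟩
  positivity

theorem aux_one_le_wWeight (n : ℕ) (p : Euc n) : 1 ≤ wWeight n p := by
  unfold wWeight
  have h1 : 1 ≤ (1 + ‖p‖) ^ (n + 1) := one_le_pow₀ (by linarith [norm_nonneg p])
  have h2 : 1 ≤ Real.exp (‖p‖ ^ 2 / 4) := Real.one_le_exp (by positivity)
  nlinarith

theorem aux_WNorm_nonneg {n : ℕ} (Y : Set (Euc n)) (f : Euc n × Euc n → ℝ) :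
    0 ≤ WNorm Y f := by
  apply Real.sSup_nonneg
  rintro _ ⟨x, _, rfl⟩
  have := aux_one_le_wWeight n x.1
  positivity

theorem aux_XNorm_nonneg {n : ℕ} (Y : Set (Euc n)) (f : Euc n × Euc n → ℝ) :
    0 ≤ XNorm Y f := by
  apply Real.sInf_nonneg
  rintro _ ⟨g, _, rfl⟩
  linarith [aux_LipNorm_nonneg Y f, aux_LipNorm_nonneg Y g, aux_gradWsup_nonneg Y g]

theorem aux_le_XNorm {n : ℕ} (Y : Set (Euc n)) (f : Euc n × Euc n → ℝ) (hf : memX Y f)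
    (x : Euc n × Euc n) (hx : x ∈ pts Y) : |f x| ≤ XNorm Y f := by
  obtain ⟨⟨⟨M, hM⟩, _⟩, g, hg, _⟩ := hf
  refine le_csInf ⟨_, g, hg, rfl⟩ ?_
  rintro _ ⟨g, _, rfl⟩
  have h1 : ‖f x‖ ≤ nsup Y f := by
    refine le_csSup ⟨M, ?_⟩ ⟨x, hx, rfl⟩
    rintro _ ⟨y, hy, rfl⟩
    exact hM y hy
  rw [Real.norm_eq_abs] at h1
  have h2 : LipNorm Y f = nsup Y f + sInf (lipSet Y f) := rfl
  linarith [aux_lip_nonneg Y f, aux_LipNorm_nonneg Y g, aux_gradWsup_nonneg Y g]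

theorem aux_le_WNorm {n : ℕ} (Y : Set (Euc n)) (f : Euc n × Euc n → ℝ) (hf : memW Y f)
    (x : Euc n × Euc n) (hx : x ∈ pts Y) : |f x| ≤ WNorm Y f := by
  obtain ⟨_, M, hM⟩ := hf
  have h1 : wWeight n x.1 * |f x| ≤ WNorm Y f := by
    refine le_csSup ⟨M, ?_⟩ ⟨x, hx, rfl⟩
    rintro _ ⟨y, hy, rfl⟩
    exact hM y hy
  nlinarith [aux_one_le_wWeight n x.1, abs_nonneg (f x)]

theorem aux_le_YNorm {n : ℕ} (Y : Set (Euc n)) (f : Euc n × Euc n → ℝ) (hf : memYp Y f)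
    (x : Euc n × Euc n) (hx : x ∈ pts Y) : |f x| ≤ YNorm Y f := by
  obtain ⟨ζ, ξ, h1, h2, h3⟩ := hf
  refine le_csInf ⟨_, ζ, ξ, h1, h2, h3, rfl⟩ ?_
  rintro _ ⟨ζ, ξ, h1, h2, h3, rfl⟩
  rw [h3 x hx]
  exact (abs_add_le _ _).trans (add_le_add (aux_le_XNorm Y ζ h1 x hx) (aux_le_WNorm Y ξ h2 x hx))

theorem aux_lipSet_const {n : ℕ} (Y : Set (Euc n)) (f : Euc n × Euc n → ℝ) (c : ℝ) :
    lipSet Y (fun x => c + f x) = lipSet Y f := by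
  simp [lipSet]

theorem aux_grad_const {n : ℕ} (Y : Set (Euc n)) (f : Euc n × Euc n → ℝ) (c : ℝ)
    (g : Euc n × Euc n → Euc n) (hg : IsSphereGrad Y f g) :
    IsSphereGrad Y (fun x => c + f x) g :=
  fun x hx => ⟨(hg x hx).1, (hg x hx).2.const_add c⟩

theorem aux_memX_const {n : ℕ} (Y : Set (Euc n)) (f : Euc n × Euc n → ℝ) (c : ℝ)
    (hf : memX Y f) : memX Y (fun x => c + f x) := by
  obtain ⟨⟨⟨M, hM⟩, hL⟩, g, hg, h⟩ := hf
  refine ⟨⟨⟨|c| + M, fun x hx => ?_⟩, ?_⟩, g, aux_grad_const Y f c g hg, h⟩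
  · exact (norm_add_le _ _).trans (add_le_add (le_of_eq (Real.norm_eq_abs c)) (hM x hx))
  · rw [aux_lipSet_const]; exact hL

theorem aux_XNorm_const {n : ℕ} (Y : Set (Euc n)) (f : Euc n × Euc n → ℝ) (c : ℝ)
    (hf : memX Y f) : XNorm Y (fun x => c + f x) ≤ |c| + XNorm Y f := by
  obtain ⟨⟨⟨M, hM⟩, hL⟩, g, hg, h⟩ := hf
  rw [← sub_le_iff_le_add']
  refine le_csInf ⟨_, g, hg, rfl⟩ ?_
  rintro _ ⟨g, hg, rfl⟩
  have hs : nsup Y (fun x => c + f x) ≤ |c| + nsup Y f := by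
    refine Real.sSup_le ?_ (add_nonneg (abs_nonneg c) (aux_nsup_nonneg Y f))
    rintro _ ⟨x, hx, rfl⟩
    have h1 : ‖f x‖ ≤ nsup Y f := by
      refine le_csSup ⟨M, ?_⟩ ⟨x, hx, rfl⟩
      rintro _ ⟨y, hy, rfl⟩
      exact hM y hy
    exact (norm_add_le _ _).trans (add_le_add (le_of_eq (Real.norm_eq_abs c)) h1)
  have hl : LipNorm Y (fun x => c + f x) ≤ |c| + LipNorm Y f := by
    unfold LipNorm
    rw [aux_lipSet_const]
    linarith
  have hx : XNorm Y (fun x => c + f x) ≤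
      LipNorm Y (fun x => c + f x) + LipNorm Y g + gradWsup Y g := by
    refine csInf_le ⟨0, ?_⟩ ⟨g, aux_grad_const Y f c g hg, rfl⟩
    rintro _ ⟨g, _, rfl⟩
    linarith [aux_LipNorm_nonneg Y (fun x => c + f x), aux_LipNorm_nonneg Y g,
      aux_gradWsup_nonneg Y g]
  linarith

theorem aux_memYp_const {n : ℕ} (Y : Set (Euc n)) (f : Euc n × Euc n → ℝ) (c : ℝ)
    (hf : memYp Y f) : memYp Y (fun x => c + f x) := by
  obtain ⟨ζ, ξ, h1, h2, h3⟩ := hf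
  exact ⟨fun x => c + ζ x, ξ, aux_memX_const Y ζ c h1, h2, fun x hx => by
    simp only [h3 x hx]; ring⟩

theorem aux_YNorm_const {n : ℕ} (Y : Set (Euc n)) (f : Euc n × Euc n → ℝ) (c : ℝ)
    (hf : memYp Y f) : YNorm Y (fun x => c + f x) ≤ |c| + YNorm Y f := by
  obtain ⟨ζ, ξ, h1, h2, h3⟩ := hf
  rw [← sub_le_iff_le_add']
  refine le_csInf ⟨_, ζ, ξ, h1, h2, h3, rfl⟩ ?_
  rintro _ ⟨ζ, ξ, h1, h2, h3, rfl⟩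
  have h : YNorm Y (fun x => c + f x) ≤ XNorm Y (fun x => c + ζ x) + WNorm Y ξ := by
    refine csInf_le ⟨0, ?_⟩ ⟨fun x => c + ζ x, ξ, aux_memX_const Y ζ c h1, h2, fun x hx => by
      simp only [h3 x hx]; ring, rfl⟩
    rintro _ ⟨ζ, ξ, _, _, _, rfl⟩
    exact add_nonneg (aux_XNorm_nonneg Y ζ) (aux_WNorm_nonneg Y ξ)
  linarith [aux_XNorm_const Y ζ c h1]

theorem aux_memW_Cc {n : ℕ} (Y : Set (Euc n)) (hY : IsClosed Y) (φ : Euc n × Euc n → ℝ)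
    (hφ : memCc Y φ) : memW Y φ := by
  obtain ⟨hc, K, hK, h0⟩ := hφ
  refine ⟨hc, ?_⟩
  have hcl : IsClosed (pts Y) := hY.prod Metric.isClosed_sphere
  have hcont : ContinuousOn (fun x : Euc n × Euc n => wWeight n x.1 * |φ x|) (pts Y) := by
    refine ContinuousOn.mul (Continuous.continuousOn ?_) hc.abs
    unfold wWeight
    fun_prop
  obtain ⟨M, hM⟩ := ((hK.inter_right hcl).image_of_continuousOn
    (hcont.mono inter_subset_right)).bddAbove
  refine ⟨max M 0, fun x hx => ?_⟩
  by_cases hxK : x ∈ K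
  · exact le_max_of_le_left (hM ⟨x, ⟨hxK, hx⟩, rfl⟩)
  · rw [h0 x hx hxK]; simp

theorem aux_memYp_sub {n : ℕ} (Y : Set (Euc n)) (f φ : Euc n × Euc n → ℝ)
    (hf : memYp Y f) (hφ : memW Y φ) : memYp Y (fun x => f x - φ x) := by
  obtain ⟨ζ, ξ, h1, ⟨hc, M, hM⟩, h3⟩ := hf
  obtain ⟨hc', M', hM'⟩ := hφ
  refine ⟨ζ, fun x => ξ x - φ x, h1, ⟨hc.sub hc', M + M', fun x hx => ?_⟩, fun x hx => ?_⟩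
  · have h := abs_sub (ξ x) (φ x)
    have hw := aux_one_le_wWeight n x.1
    calc wWeight n x.1 * |ξ x - φ x| ≤ wWeight n x.1 * (|ξ x| + |φ x|) := by gcongr
      _ ≤ M + M' := by rw [mul_add]; exact add_le_add (hM x hx) (hM' x hx)
  · simp only [h3 x hx]; ring

theorem aux_exists_far {n : ℕ} (Y : Set (Euc n)) (hY : ¬ Bornology.IsBounded Y)
    (K : Set (Euc n × Euc n)) (hK : IsCompact K) : ∃ x ∈ pts Y, x ∉ K := by
  by_contra! h
  apply hY
  refine (hK.image continuous_fst).isBounded.subset fun p hp => ?_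
  refine ⟨(p, EuclideanSpace.single 0 1), h _ ⟨hp, ?_⟩, rfl⟩
  simp [Sph]

/-- For `n ≥ 2` and `Y ⊆ ℝ^{n+1}` unbounded and closed, for every `c ∈ ℝ`
and `ψ ∈ 𝔜₀(Y)` one has `(1/4)(|c| + ‖ψ‖_𝔜) ≤ ‖c·𝟙 + ψ‖_𝔜 ≤ |c| + ‖ψ‖_𝔜`. -/
theorem YNorm_decomposition_estimate
    (n : ℕ) (hn : 2 ≤ n) (Y : Set (Euc n)) (hYclosed : IsClosed Y)
    (hYunbounded : ¬ Bornology.IsBounded Y)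
    (c : ℝ) (ψ : Euc n × Euc n → ℝ) (hψ : memY0 Y ψ) :
    (1 / 4) * (|c| + YNorm Y ψ) ≤ YNorm Y (fun x => c + ψ x) ∧
    YNorm Y (fun x => c + ψ x) ≤ |c| + YNorm Y ψ := by
  have hp := hψ.1
  have hp' := aux_memYp_const Y ψ c hp
  have hup := aux_YNorm_const Y ψ c hp
  refine ⟨?_, hup⟩
  have hc : |c| ≤ YNorm Y (fun x => c + ψ x) := by
    refine le_of_forall_pos_le_add fun ε hε => ?_
    obtain ⟨φ, hφ, hlt⟩ := hψ.2 ε hε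
    have hW := aux_memW_Cc Y hYclosed φ hφ
    obtain ⟨_, K, hK, h0⟩ := hφ
    obtain ⟨x, hx, hxK⟩ := aux_exists_far Y hYunbounded K hK
    have h1 := aux_le_YNorm Y _ hp' x hx
    have h2 := aux_le_YNorm Y _ (aux_memYp_sub Y ψ φ hp hW) x hx
    simp only [h0 x hx hxK, sub_zero] at h2
    have h3 : |c| ≤ |c + ψ x| + |ψ x| := by
      have := abs_sub (c + ψ x) (ψ x)
      simpa using this
    linarith
  have hd := aux_YNorm_const Y _ (-c) hp'
  simp only [neg_add_cancel_left, abs_neg] at hd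
  have := abs_nonneg c
  linarith
end
end

section
/- Let n ≥ 2 and fix constants ℛ₁ > 1, M₀ > 0, C̃₀ > 0 and T > 0. Let χ : ℝ^{n+1} → [0,1] be smooth with χ ≡ 0 on the closed ball of radius ℛ₁ and χ ≡ 1 outside the ball of radius ℛ₁+1. Let α ∈ ℝ with |α| ≤ M₀ and let Y : ℝ^{n+1} → ℝ^{n+1} be smooth with sup_p (1+|p|)³ |Y(p) − αχ(p)|p|^{-2}p| ≤ C̃₀ (interpreting αχ(p)|p|^{-2}p as 0 for |p| ≤ ℛ₁) and Σ_{l=1}^{3} sup_p (1+|p|)² |∇^l Y(p)| ≤ C̃₀. Let Φ : [0,T] × ℝ^{n+1} → ℝ^{n+1} be smooth with Φ(0,p) = p and ∂Φ/∂t(t,p) = Y(Φ(t,p)). Then there is a constant C̃₁ > 0, depending only on n, ℛ₁, M₀, C̃₀ and T, such that for all t ∈ [0,T] and all p ∈ ℝ^{n+1}: (i) | |Φ(t,p)|² − |p|² − 2αt | ≤ C̃₁(1+|p|)^{-2}; (ii) |∇_pΦ(t,p) − I| ≤ C̃₁(1+|p|)^{-2}, where I is the identity map of ℝ^{n+1};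 (iii) |∇_p²Φ(t,p)| + |∇_p³Φ(t,p)| ≤ C̃₁(1+|p|)^{-2}. -/
noncomputable section

open Set Metric Real Filter
open scoped RealInnerProductSpace

lemma swap_aux {E H : Type*} [NormedAddCommGroup E] [NormedSpace ℝ E]
    [NormedAddCommGroup H] [NormedSpace ℝ H] {T : ℝ} (hT : 0 < T) (F G : ℝ → E → H)
    (hF : ContDiffOn ℝ (⊤ : ℕ∞) (fun q : ℝ × E => F q.1 q.2) (Set.Icc (0 : ℝ) T ×ˢ Set.univ))
    (hd : ∀ p, ∀ t ∈ Set.Icc (0 : ℝ) T,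
      HasDerivWithinAt (fun s => F s p) (G t p) (Set.Icc (0 : ℝ) T) t) :
    ContDiffOn ℝ (⊤ : ℕ∞) (fun q : ℝ × E => fderiv ℝ (F q.1) q.2)
        (Set.Icc (0 : ℝ) T ×ˢ Set.univ) ∧
    ∀ p, ∀ t ∈ Set.Icc (0 : ℝ) T,
      HasDerivWithinAt (fun s => fderiv ℝ (F s) p) (fderiv ℝ (G t) p) (Set.Icc (0 : ℝ) T) t := by
  set S : Set (ℝ × E) := Set.Icc (0 : ℝ) T ×ˢ Set.univ with hS
  set U : ℝ × E → H := fun q => F q.1 q.2 with hU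
  have hSu : UniqueDiffOn ℝ S := (uniqueDiffOn_Icc hT).prod uniqueDiffOn_univ
  set D := fderivWithin ℝ U S with hD
  have hDc : ContDiffOn ℝ (⊤ : ℕ∞) D S := hF.fderivWithin hSu (by simp)
  have hmem : ∀ t ∈ Set.Icc (0 : ℝ) T, ∀ p : E, (t, p) ∈ S := fun t ht p => ⟨ht, mem_univ _⟩
  have hUd : ∀ q ∈ S, HasFDerivWithinAt U (D q) S q := fun q hq =>
    (hF.differentiableOn (by simp) q hq).hasFDerivWithinAt
  have hDd : ∀ q ∈ S, HasFDerivWithinAt D (fderivWithin ℝ D S q) S q := fun q hq =>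
    (hDc.differentiableOn (by simp) q hq).hasFDerivWithinAt
  have hr : ∀ (t : ℝ) (p : E), HasFDerivWithinAt (fun p : E => (t, p))
      (ContinuousLinearMap.inr ℝ ℝ E) Set.univ p := fun t p =>
    (hasFDerivAt_prodMk_right t p).hasFDerivWithinAt
  have hl : ∀ (t : ℝ) (p : E), HasDerivWithinAt (fun s : ℝ => (s, p))
      ((1 : ℝ), (0 : E)) (Set.Icc 0 T) t := fun t p =>
    (hasDerivWithinAt_id t _).prodMk (hasDerivWithinAt_const t _ p)
  have h1 : ∀ t ∈ Set.Icc (0 : ℝ) T, ∀ p : E,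
      fderiv ℝ (F t) p = (D (t, p)).comp (ContinuousLinearMap.inr ℝ ℝ E) := by
    intro t ht p
    have := (hUd (t, p) (hmem t ht p)).comp p (hr t p) (fun q _ => hmem t ht q)
    rw [hasFDerivWithinAt_univ] at this
    exact this.fderiv
  have h2 : ∀ t ∈ Set.Icc (0 : ℝ) T, ∀ p : E, G t p = D (t, p) (1, 0) := by
    intro t ht p
    have := (hUd (t, p) (hmem t ht p)).comp_hasDerivWithinAt t (hl t p) (fun s hs => hmem s hs p)
    exact (uniqueDiffOn_Icc hT t ht).eq_deriv _ (hd p t ht) this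
  constructor
  · have : ContDiffOn ℝ (⊤ : ℕ∞)
        (fun q => (D q).comp (ContinuousLinearMap.inr ℝ ℝ E)) S :=
      hDc.clm_comp contDiffOn_const
    refine this.congr ?_
    rintro ⟨t, p⟩ hq
    exact h1 t hq.1 p
  · intro p t ht
    have ha := (hDd (t, p) (hmem t ht p)).comp_hasDerivWithinAt t (hl t p)
      (fun s hs => hmem s hs p)
    have hb : HasDerivWithinAt (fun s => (D (s, p)).comp (ContinuousLinearMap.inr ℝ ℝ E))
        ((fderivWithin ℝ D S (t, p) (1, 0)).comp (ContinuousLinearMap.inr ℝ ℝ E))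
        (Set.Icc 0 T) t := by
      have := ((ContinuousLinearMap.compL ℝ E (ℝ × E) H).flip
        (ContinuousLinearMap.inr ℝ ℝ E)).hasFDerivAt.comp_hasDerivWithinAt t ha
      exact this
    have hc := (hDd (t, p) (hmem t ht p)).comp p (hr t p) (fun q _ => hmem t ht q)
    rw [hasFDerivWithinAt_univ] at hc
    have hGt : G t = fun p => D (t, p) (1, 0) := funext (h2 t ht)
    have hd' := (ContinuousLinearMap.apply ℝ H ((1 : ℝ), (0 : E))).hasFDerivAt.comp p hc
    have he := hd'.fderiv
    have hsymm : IsSymmSndFDerivWithinAt ℝ U S (t, p) := by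
      refine (hF (t, p) (hmem t ht p)).isSymmSndFDerivWithinAt
        (by simp only [minSmoothness_of_isRCLikeNormedField]; exact WithTop.coe_le_coe.2 le_top) hSu ?_ (hmem t ht p)
      rw [hS, interior_prod_eq, closure_prod_eq, interior_Icc, closure_Ioo hT.ne]
      simpa using ht
    have hfin := hb.congr (fun s hs => h1 s hs p) (h1 t ht p)
    have key : fderiv ℝ (G t) p =
        (fderivWithin ℝ D S (t, p) (1, 0)).comp (ContinuousLinearMap.inr ℝ ℝ E) := by
      rw [hGt]
      refine he.trans ?_
      ext v
      exact hsymm (0, v) (1, 0)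
    rw [key]
    exact hfin

lemma gron {H : Type*} [NormedAddCommGroup H] [NormedSpace ℝ H] {T : ℝ} (f f' : ℝ → H)
    (δ K ε : ℝ) (hK : 0 < K) (hδ : 0 ≤ δ) (hε : 0 ≤ ε)
    (hd : ∀ t ∈ Set.Icc (0 : ℝ) T, HasDerivWithinAt f (f' t) (Set.Icc (0 : ℝ) T) t)
    (h0 : ‖f 0‖ ≤ δ) (hb : ∀ t ∈ Set.Icc (0 : ℝ) T, ‖f' t‖ ≤ K * ‖f t‖ + ε) :
    ∀ t ∈ Set.Icc (0 : ℝ) T, ‖f t‖ ≤ (δ + ε / K) * Real.exp (K * T) := by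
  intro t ht
  have := norm_le_gronwallBound_of_norm_deriv_right_le (f := f) (f' := f') (δ := δ) (K := K)
    (ε := ε) (a := 0) (b := T) (fun t ht => (hd t ht).continuousWithinAt)
    (fun x hx => (hd x ⟨hx.1, hx.2.le⟩).mono_of_mem_nhdsWithin (Icc_mem_nhdsGE_of_mem hx)) h0
    (fun x hx => hb x ⟨hx.1, hx.2.le⟩) t ht
  rw [gronwallBound_of_K_ne_0 hK.ne', sub_zero] at this
  have h1 : Real.exp (K * t) ≤ Real.exp (K * T) := Real.exp_le_exp.2 (by nlinarith [ht.2])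
  have h2 : 0 ≤ ε / K := by positivity
  nlinarith [mul_le_mul_of_nonneg_left h1 hδ, mul_le_mul_of_nonneg_left h1 h2]

/-- Pointwise bounds for the right-hand sides of the variational equations. -/
lemma rhs_bounds {E : Type} [NormedAddCommGroup E] [NormedSpace ℝ E] (Y φ : E → E) (hY : ContDiff ℝ (⊤ : ℕ∞) Y)
    (hφ : ContDiff ℝ (⊤ : ℕ∞) φ) (p : E) (a : ℝ)
    (hb : ‖iteratedFDeriv ℝ 1 Y (φ p)‖ +
          ‖iteratedFDeriv ℝ 2 Y (φ p)‖ + ‖iteratedFDeriv ℝ 3 Y (φ p)‖ ≤ a) :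
    ‖fderiv ℝ (fun q => Y (φ q)) p‖ ≤ a * ‖fderiv ℝ φ p‖ ∧
    ‖fderiv ℝ (fderiv ℝ (fun q => Y (φ q))) p‖ ≤
      a * ‖fderiv ℝ (fderiv ℝ φ) p‖ + a * ‖fderiv ℝ φ p‖ ^ 2 ∧
    (∀ d : ℝ, ‖fderiv ℝ φ p‖ ≤ d → ‖fderiv ℝ (fderiv ℝ φ) p‖ ≤ d ^ 2 →
      ‖fderiv ℝ (fderiv ℝ (fderiv ℝ (fun q => Y (φ q)))) p‖ ≤
      a * ‖fderiv ℝ (fderiv ℝ (fderiv ℝ φ)) p‖ +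
        2 * (a * ‖fderiv ℝ φ p‖) * ‖fderiv ℝ (fderiv ℝ φ) p‖ +
        2 * a * d ^ 2 * ‖fderiv ℝ φ p‖) := by
  have hYd : Differentiable ℝ Y := hY.differentiable (by simp)
  have hφd : Differentiable ℝ φ := hφ.differentiable (by simp)
  have hY' : ContDiff ℝ (⊤ : ℕ∞) (fderiv ℝ Y) := hY.fderiv_right (by simp)
  have hφ' : ContDiff ℝ (⊤ : ℕ∞) (fderiv ℝ φ) := hφ.fderiv_right (by simp)
  have hYφ : ContDiff ℝ (⊤ : ℕ∞) (fderiv ℝ Y ∘ φ) := hY'.comp hφ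
  have e1 : fderiv ℝ (fun q => Y (φ q)) = fun q =>
      ContinuousLinearMap.compL ℝ E E E ((fderiv ℝ Y ∘ φ) q) (fderiv ℝ φ q) := by
    funext q
    exact fderiv_fun_comp q (hYd _) (hφd _)
  have y1 : ‖fderiv ℝ Y (φ p)‖ ≤ a := by
    rw [← norm_iteratedFDeriv_one]
    linarith [norm_nonneg (iteratedFDeriv ℝ 2 Y (φ p)), norm_nonneg (iteratedFDeriv ℝ 3 Y (φ p))]
  have y2 : ‖iteratedFDeriv ℝ 1 (fderiv ℝ Y) (φ p)‖ ≤ a := by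
    rw [norm_iteratedFDeriv_fderiv]
    linarith [norm_nonneg (iteratedFDeriv ℝ 1 Y (φ p)), norm_nonneg (iteratedFDeriv ℝ 3 Y (φ p))]
  have y3 : ‖iteratedFDeriv ℝ 2 (fderiv ℝ Y) (φ p)‖ ≤ a := by
    rw [norm_iteratedFDeriv_fderiv]
    linarith [norm_nonneg (iteratedFDeriv ℝ 1 Y (φ p)), norm_nonneg (iteratedFDeriv ℝ 2 Y (φ p))]
  have ha : 0 ≤ a := (norm_nonneg _).trans y1
  have two : ∀ {H : Type} [NormedAddCommGroup H] [NormedSpace ℝ H] (f : E → H),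
      ‖iteratedFDeriv ℝ 2 f p‖ = ‖fderiv ℝ (fderiv ℝ f) p‖ := by
    intro H _ _ f
    rw [← norm_iteratedFDeriv_fderiv, norm_iteratedFDeriv_one]
  have z1 : ‖fderiv ℝ (fderiv ℝ Y ∘ φ) p‖ ≤ a * ‖fderiv ℝ φ p‖ := by
    rw [fderiv_comp p (hY'.differentiable (by simp) _) (hφd _)]
    refine (ContinuousLinearMap.opNorm_comp_le _ _).trans ?_
    rw [norm_iteratedFDeriv_one] at y2
    gcongr
  have hB := ContinuousLinearMap.norm_compL_le ℝ E E E
  refine ⟨?_, ?_, ?_⟩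
  · rw [e1]
    refine (ContinuousLinearMap.opNorm_comp_le _ _).trans ?_
    gcongr
    exact y1
  · rw [e1, ← norm_iteratedFDeriv_one]
    refine (ContinuousLinearMap.norm_iteratedFDeriv_le_of_bilinear_of_le_one _ hYφ hφ' p
      (n := 1) (by simp) hB).trans ?_
    simp only [Finset.sum_range_succ, Finset.sum_range_zero, norm_iteratedFDeriv_zero,
      norm_iteratedFDeriv_one, Nat.choose_self, Nat.choose_zero_right, Nat.cast_one, one_mul,
      zero_add, Nat.sub_zero, Nat.reduceSub, Nat.sub_self, Function.comp_apply]
    have := mul_le_mul_of_nonneg_right z1 (norm_nonneg (fderiv ℝ φ p))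
    have := mul_le_mul_of_nonneg_right y1 (norm_nonneg (fderiv ℝ (fderiv ℝ φ) p))
    linarith
  · intro d h1 h2
    have z2 : ‖fderiv ℝ (fderiv ℝ (fderiv ℝ Y ∘ φ)) p‖ ≤ 2 * a * d ^ 2 := by
      rw [← two]
      refine (norm_iteratedFDeriv_comp_le hY' hφ (n := 2) (WithTop.coe_le_coe.2 le_top) p
        (C := a) (D := d) ?_ ?_).trans (by simp [Nat.factorial])
      · intro i hi
        interval_cases i
        · rwa [norm_iteratedFDeriv_zero]
        · exact y2
        · exact y3
      · intro i hi hi'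
        interval_cases i
        · rwa [norm_iteratedFDeriv_one, pow_one]
        · rwa [two]
    rw [e1, ← two]
    refine (ContinuousLinearMap.norm_iteratedFDeriv_le_of_bilinear_of_le_one _ hYφ hφ' p
      (n := 2) (WithTop.coe_le_coe.2 le_top) hB).trans ?_
    simp only [Finset.sum_range_succ, Finset.sum_range_zero, norm_iteratedFDeriv_zero,
      norm_iteratedFDeriv_one, Nat.choose_self, Nat.choose_zero_right, Nat.cast_one, one_mul,
      zero_add, Nat.sub_zero, Nat.reduceSub, Nat.sub_self, Function.comp_apply, two, Nat.reduceSub,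
      Nat.choose_one_right, Nat.cast_ofNat]
    have := mul_le_mul_of_nonneg_right z1 (norm_nonneg (fderiv ℝ (fderiv ℝ φ) p))
    have := mul_le_mul_of_nonneg_right z2 (norm_nonneg (fderiv ℝ φ p))
    have := mul_le_mul_of_nonneg_right y1 (norm_nonneg (fderiv ℝ (fderiv ℝ (fderiv ℝ φ)) p))
    linarith

/-- Pointwise bounds on `Y`. -/
lemma field_bounds {n : ℕ} {R₁ M₀ C₀ α : ℝ} (hR₁ : 1 < R₁) (hM₀ : 0 < M₀)
    (χ : Euc n → ℝ) (Y : Euc n → Euc n) (h01 : ∀ p, χ p ∈ Set.Icc (0 : ℝ) 1)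
    (hz : ∀ p : Euc n, ‖p‖ ≤ R₁ → χ p = 0) (ho : ∀ p : Euc n, R₁ + 1 ≤ ‖p‖ → χ p = 1)
    (hα : |α| ≤ M₀)
    (hY : ∀ p : Euc n, (1 + ‖p‖) ^ 3 * ‖Y p - (α * χ p * (‖p‖ ^ 2)⁻¹) • p‖ ≤ C₀) (q : Euc n) :
    ‖Y q‖ ≤ C₀ + M₀ ∧
    |⟪q, Y q⟫ - α| ≤ (C₀ + M₀ * (R₁ + 2) ^ 2) * ((1 + ‖q‖) ^ 2)⁻¹ := by
  have hq := norm_nonneg q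
  set Z := Y q - (α * χ q * (‖q‖ ^ 2)⁻¹) • q with hZ
  have hYZ : Y q = Z + (α * χ q * (‖q‖ ^ 2)⁻¹) • q := by rw [hZ]; abel
  have h3 := hY q
  rw [← hZ] at h3
  have hZn := norm_nonneg Z
  have hZ1 : ‖Z‖ ≤ C₀ := by
    have : (1 : ℝ) ≤ (1 + ‖q‖) ^ 3 := one_le_pow₀ (by linarith)
    nlinarith
  have hpos : (0 : ℝ) < (1 + ‖q‖) ^ 2 := by positivity
  have hZ2 : ‖q‖ * ‖Z‖ ≤ C₀ * ((1 + ‖q‖) ^ 2)⁻¹ := by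
    rw [← div_eq_mul_inv, le_div_iff₀ hpos]
    nlinarith [mul_nonneg hpos.le hZn]
  have hin : ⟪q, Y q⟫ = ⟪q, Z⟫ + α * χ q := by
    rw [hYZ, inner_add_right, inner_smul_right, real_inner_self_eq_norm_sq]
    by_cases h0 : ‖q‖ = 0
    · rw [hz q (by linarith)]; simp
    · field_simp
  constructor
  · rw [hYZ]
    refine (norm_add_le _ _).trans (add_le_add hZ1 ?_)
    by_cases h : ‖q‖ ≤ R₁
    · rw [hz q h]; simpa using hM₀.le
    · push Not at h
      rw [norm_smul, Real.norm_eq_abs, abs_mul, abs_mul, abs_of_nonneg (h01 q).1,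
        abs_of_nonneg (by positivity : (0 : ℝ) ≤ (‖q‖ ^ 2)⁻¹)]
      have h1 : (‖q‖ ^ 2)⁻¹ * ‖q‖ ≤ 1 := by
        rw [inv_mul_le_iff₀ (by nlinarith)]; nlinarith
      have h2 : |α| * χ q ≤ M₀ * 1 := mul_le_mul hα (h01 q).2 (h01 q).1 hM₀.le
      have h4 : (0 : ℝ) ≤ (‖q‖ ^ 2)⁻¹ * ‖q‖ := by positivity
      rw [mul_assoc]
      calc |α| * χ q * ((‖q‖ ^ 2)⁻¹ * ‖q‖) ≤ (M₀ * 1) * 1 :=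
            mul_le_mul h2 h1 h4 (by linarith)
        _ = M₀ := by ring
  · have e : ⟪q, Y q⟫ - α = ⟪q, Z⟫ + (-(α * (1 - χ q))) := by rw [hin]; ring
    rw [e, add_mul]
    refine (abs_add_le _ _).trans (add_le_add ((abs_real_inner_le_norm _ _).trans hZ2) ?_)
    rw [abs_neg, abs_mul, abs_of_nonneg (by linarith [(h01 q).2] : (0 : ℝ) ≤ 1 - χ q)]
    by_cases h : R₁ + 1 ≤ ‖q‖
    · rw [ho q h]; simp only [sub_self, mul_zero]; positivity
    · push Not at h
      rw [← div_eq_mul_inv, le_div_iff₀ hpos]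
      have h2 : |α| * (1 - χ q) ≤ M₀ * 1 :=
        mul_le_mul hα (by linarith [(h01 q).1]) (by linarith [(h01 q).2]) hM₀.le
      rw [mul_one] at h2
      exact mul_le_mul h2 (pow_le_pow_left₀ (by linarith) (by linarith) 2) hpos.le hM₀.le


set_option maxSynthPendingDepth 5 in
/-- Bounds on the spatial derivatives of the flow. -/
lemma var_bounds {X : Type} [NormedAddCommGroup X] [NormedSpace ℝ X] {T A w E : ℝ} (hT : 0 < T)
    (hAp : 0 < A) (hwp : 0 < w) (hw1 : w ≤ 1) (hEdef : E = Real.exp (A * T))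
    (Y : X → X) (Φ : ℝ → X → X) (hY : ContDiff ℝ (⊤ : ℕ∞) Y)
    (hΦ : ContDiffOn ℝ (⊤ : ℕ∞) (fun q : ℝ × X => Φ q.1 q.2) (Set.Icc (0 : ℝ) T ×ˢ Set.univ))
    (hΦt : ∀ t ∈ Set.Icc (0 : ℝ) T, ContDiff ℝ (⊤ : ℕ∞) (Φ t)) (h0 : ∀ p, Φ 0 p = p)
    (hd : ∀ p, ∀ t ∈ Set.Icc (0 : ℝ) T,
      HasDerivWithinAt (fun s => Φ s p) (Y (Φ t p)) (Set.Icc (0 : ℝ) T) t) (p : X)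
    (hYb : ∀ s ∈ Set.Icc (0 : ℝ) T, ‖iteratedFDeriv ℝ 1 Y (Φ s p)‖ +
          ‖iteratedFDeriv ℝ 2 Y (Φ s p)‖ + ‖iteratedFDeriv ℝ 3 Y (Φ s p)‖ ≤ A * w)
    (t : ℝ) (ht : t ∈ Set.Icc (0 : ℝ) T) :
    ‖fderiv ℝ (Φ t) p - ContinuousLinearMap.id ℝ X‖ ≤ A * E * T * w ∧
    ‖iteratedFDeriv ℝ 2 (Φ t) p‖ ≤ E ^ 3 * w ∧
    ‖iteratedFDeriv ℝ 3 (Φ t) p‖ ≤ 4 * E ^ 8 * w := by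
  have hE1 : 1 ≤ E := hEdef ▸ Real.one_le_exp (by positivity)
  have hEp : 0 < E := by positivity
  -- variational equations
  obtain ⟨c1, d1⟩ := swap_aux hT Φ (fun t q => Y (Φ t q)) hΦ hd
  obtain ⟨c2, d2⟩ := swap_aux hT (fun t => fderiv ℝ (Φ t))
    (fun t => fderiv ℝ (fun q => Y (Φ t q))) c1 d1
  obtain ⟨c3, d3⟩ := swap_aux hT (fun t => fderiv ℝ (fderiv ℝ (Φ t)))
    (fun t => fderiv ℝ (fderiv ℝ (fun q => Y (Φ t q)))) c2 d2
  have hrhs := fun s hs => rhs_bounds Y (Φ s) hY (hΦt s hs) p (A * w) (hYb s hs)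
  have i0 : Φ 0 = id := funext h0
  have i1 : fderiv ℝ (Φ 0) = fun _ => ContinuousLinearMap.id ℝ X := by
    rw [i0]; funext q; exact fderiv_id
  have i2 : fderiv ℝ (fderiv ℝ (Φ 0)) = fun _ => 0 := by
    rw [i1]; funext q; simp
  have i3 : fderiv ℝ (fderiv ℝ (fderiv ℝ (Φ 0))) = fun _ => 0 := by
    rw [i2]; funext q; simp
  have hAw : A * w ≤ A := by nlinarith
  -- first derivative
  have b1 : ∀ s ∈ Set.Icc (0 : ℝ) T, ‖fderiv ℝ (Φ s) p‖ ≤ E := by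
    intro s hs
    have := gron (T := T) (fun s => fderiv ℝ (Φ s) p) _ 1 A 0 hAp zero_le_one le_rfl (d1 p)
      (by simp only [i1]; exact ContinuousLinearMap.norm_id_le)
      (fun r hr => by
        have := (hrhs r hr).1
        have := mul_le_mul_of_nonneg_right hAw (norm_nonneg (fderiv ℝ (Φ r) p))
        linarith) s hs
    rw [← hEdef] at this
    simpa using this
  have b1' : ‖fderiv ℝ (Φ t) p - ContinuousLinearMap.id ℝ X‖ ≤ A * E * T * w := by
    have h1 := norm_image_sub_le_of_norm_deriv_le_segment' (d1 p) (C := A * w * E)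
      (fun x hx => by
        have hx' : x ∈ Set.Icc (0 : ℝ) T := ⟨hx.1, hx.2.le⟩
        exact (hrhs x hx').1.trans
          (mul_le_mul_of_nonneg_left (b1 x hx') (by positivity))) t ht
    simp only [i1, sub_zero] at h1
    have := mul_le_mul_of_nonneg_left ht.2 (by positivity : 0 ≤ A * w * E)
    calc _ ≤ _ := h1
      _ ≤ _ := this
      _ = _ := by ring
  -- second derivative
  have b2 : ∀ s ∈ Set.Icc (0 : ℝ) T, ‖fderiv ℝ (fderiv ℝ (Φ s)) p‖ ≤ E ^ 3 * w := by
    intro s hs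
    have := gron (T := T) (fun s => fderiv ℝ (fderiv ℝ (Φ s)) p) _ 0 A (A * w * E ^ 2) hAp le_rfl
      (by positivity) (d2 p) (by
        have : ‖fderiv ℝ (fderiv ℝ (Φ 0)) p‖ ≤ 0 := by rw [i2, norm_zero]
        exact this)
      (fun r hr => by
        have h1 := (hrhs r hr).2.1
        have h2 := mul_le_mul_of_nonneg_right hAw (norm_nonneg (fderiv ℝ (fderiv ℝ (Φ r)) p))
        have h3 := mul_le_mul_of_nonneg_left (pow_le_pow_left₀ (norm_nonneg _) (b1 r hr) 2)
          (by positivity : 0 ≤ A * w)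
        exact h1.trans (add_le_add h2 h3)) s hs
    refine this.trans (le_of_eq ?_)
    rw [← hEdef]; field_simp; ring
  -- third derivative
  have b3 : ∀ s ∈ Set.Icc (0 : ℝ) T, ‖fderiv ℝ (fderiv ℝ (fderiv ℝ (Φ s))) p‖ ≤ 4 * E ^ 8 * w := by
    intro s hs
    have := gron (T := T) (fun s => fderiv ℝ (fderiv ℝ (fderiv ℝ (Φ s))) p) _ 0 A
      (4 * A * w * E ^ 7) hAp le_rfl
      (by positivity) (d3 p) (by
        have : ‖fderiv ℝ (fderiv ℝ (fderiv ℝ (Φ 0))) p‖ ≤ 0 := by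
          rw [i3]
          exact (norm_zero (E := X →L[ℝ] X →L[ℝ] X →L[ℝ] X)).le
        exact this)
      (fun r hr => by
        have b2r : ‖fderiv ℝ (fderiv ℝ (Φ r)) p‖ ≤ E ^ 3 := (b2 r hr).trans
          (mul_le_of_le_one_right (by positivity) hw1)
        have e13 : E ≤ E ^ 3 := le_self_pow₀ hE1 (by norm_num)
        have e36 : E ^ 3 ≤ (E ^ 3) ^ 2 := le_self_pow₀ (one_le_pow₀ hE1) (by norm_num)
        have h1 := (hrhs r hr).2.2 (E ^ 3) ((b1 r hr).trans e13) (b2r.trans e36)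
        have h2 := mul_le_mul_of_nonneg_right hAw
          (norm_nonneg (fderiv ℝ (fderiv ℝ (fderiv ℝ (Φ r))) p))
        have h3 : 2 * (A * w * ‖fderiv ℝ (Φ r) p‖) * ‖fderiv ℝ (fderiv ℝ (Φ r)) p‖ ≤
            2 * (A * w * E) * E ^ 3 := by
          have := b1 r hr
          gcongr
        have h4 : 2 * (A * w) * (E ^ 3) ^ 2 * ‖fderiv ℝ (Φ r) p‖ ≤
            2 * (A * w) * (E ^ 3) ^ 2 * E := by
          have := b1 r hr
          gcongr
        have h5 : 2 * (A * w) * E ^ 4 ≤ 2 * (A * w) * E ^ 7 := by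
          have : E ^ 4 ≤ E ^ 7 := pow_le_pow_right₀ hE1 (by norm_num)
          gcongr
        refine h1.trans ?_
        have e1 : 2 * (A * w * E) * E ^ 3 = 2 * (A * w) * E ^ 4 := by ring
        have e2 : 2 * (A * w) * (E ^ 3) ^ 2 * E = 2 * (A * w) * E ^ 7 := by ring
        linarith) s hs
    refine this.trans (le_of_eq ?_)
    rw [← hEdef]; field_simp; ring
  refine ⟨b1', ?_, ?_⟩
  · rw [← norm_iteratedFDeriv_fderiv, norm_iteratedFDeriv_one]
    exact b2 t ht
  · rw [← norm_iteratedFDeriv_fderiv, ← norm_iteratedFDeriv_fderiv, norm_iteratedFDeriv_one]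
    exact b3 t ht

/-- Lemma A.2 of Bernstein–Wang, estimates on the flow `Φ` of the
vector field `Y`. There is `C₁ > 0`, depending only on `n`, `ℛ₁`, `M₀`, `C₀` and `T`,
bounding `||Φ(t,p)|² − |p|² − 2αt|`, `|∇_pΦ − I|` and `|∇²_pΦ| + |∇³_pΦ|` by
`C₁ (1+|p|)⁻²` on `[0,T] × ℝ^{n+1}`. -/
theorem flow_estimates
    (n : ℕ) (hn : 2 ≤ n) (R₁ M₀ C₀ T : ℝ)
    (hR₁ : 1 < R₁) (hM₀ : 0 < M₀) (hC₀ : 0 < C₀) (hT : 0 < T) :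
    ∃ C₁ : ℝ, 0 < C₁ ∧
      ∀ (χ : Euc n → ℝ) (α : ℝ) (Y : Euc n → Euc n) (Φ : ℝ → Euc n → Euc n),
        ContDiff ℝ (⊤ : ℕ∞) χ → (∀ p, χ p ∈ Set.Icc (0 : ℝ) 1) →
        (∀ p : Euc n, ‖p‖ ≤ R₁ → χ p = 0) → (∀ p : Euc n, R₁ + 1 ≤ ‖p‖ → χ p = 1) →
        |α| ≤ M₀ → ContDiff ℝ (⊤ : ℕ∞) Y →
        (∀ p : Euc n, (1 + ‖p‖) ^ 3 * ‖Y p - (α * χ p * (‖p‖ ^ 2)⁻¹) • p‖ ≤ C₀) →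
        (∀ p : Euc n, (1 + ‖p‖) ^ 2 * (‖iteratedFDeriv ℝ 1 Y p‖ +
          ‖iteratedFDeriv ℝ 2 Y p‖ + ‖iteratedFDeriv ℝ 3 Y p‖) ≤ C₀) →
        ContDiffOn ℝ (⊤ : ℕ∞) (fun q : ℝ × Euc n => Φ q.1 q.2)
          (Set.Icc (0 : ℝ) T ×ˢ Set.univ) →
        (∀ t ∈ Set.Icc (0 : ℝ) T, ContDiff ℝ (⊤ : ℕ∞) (Φ t)) →
        (∀ p, Φ 0 p = p) →
        (∀ p, ∀ t ∈ Set.Icc (0 : ℝ) T,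
          HasDerivWithinAt (fun s => Φ s p) (Y (Φ t p)) (Set.Icc (0 : ℝ) T) t) →
        ∀ t ∈ Set.Icc (0 : ℝ) T, ∀ p : Euc n,
          |‖Φ t p‖ ^ 2 - ‖p‖ ^ 2 - 2 * α * t| ≤ C₁ * ((1 + ‖p‖) ^ 2)⁻¹ ∧
          ‖fderiv ℝ (Φ t) p - ContinuousLinearMap.id ℝ (Euc n)‖ ≤ C₁ * ((1 + ‖p‖) ^ 2)⁻¹ ∧
          ‖iteratedFDeriv ℝ 2 (Φ t) p‖ + ‖iteratedFDeriv ℝ 3 (Φ t) p‖ ≤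
            C₁ * ((1 + ‖p‖) ^ 2)⁻¹ := by
  set A : ℝ := C₀ * (1 + (C₀ + M₀) * T) ^ 2 with hA
  set E : ℝ := Real.exp (A * T) with hE
  set L : ℝ := 1 + (C₀ + M₀) * T with hL
  set Cc : ℝ := C₀ + M₀ * (R₁ + 2) ^ 2 with hCc
  have hLp : 0 < L := by positivity
  have hAp : 0 < A := by positivity
  have hE1 : 1 ≤ E := Real.one_le_exp (by positivity)
  have hEp : 0 < E := by positivity
  have hCp : 0 < Cc := by positivity
  refine ⟨2 * Cc * L ^ 2 * T + A * E * T + (E ^ 3 + 4 * E ^ 8), by positivity, ?_⟩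
  intro χ α Y Φ _ h01 hz ho hα hY hY0 hYd hΦ hΦt h0 hd t ht p
  have hp := norm_nonneg p
  have hfb := field_bounds hR₁ hM₀ χ Y h01 hz ho hα hY0
  set w : ℝ := ((1 + ‖p‖) ^ 2)⁻¹ with hw
  have hwp : 0 < w := by positivity
  have hw1 : w ≤ 1 := inv_le_one_of_one_le₀ (one_le_pow₀ (by linarith))
  -- displacement
  have hdisp : ∀ s ∈ Set.Icc (0 : ℝ) T, ((1 + ‖Φ s p‖) ^ 2)⁻¹ ≤ L ^ 2 * w := by
    intro s hs
    have h1 := norm_image_sub_le_of_norm_deriv_le_segment' (hd p)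
      (fun x _ => (hfb (Φ x p)).1) s hs
    rw [h0, sub_zero] at h1
    have h2 : ‖p‖ ≤ ‖Φ s p‖ + ‖Φ s p - p‖ := by
      have := norm_sub_le (Φ s p) (Φ s p - p)
      simpa using this
    have h3 : (C₀ + M₀) * s ≤ (C₀ + M₀) * T :=
      mul_le_mul_of_nonneg_left hs.2 (by positivity)
    have hφ := norm_nonneg (Φ s p)
    have h4 : 1 + ‖p‖ ≤ L * (1 + ‖Φ s p‖) := by
      have : 0 ≤ (C₀ + M₀) * T * ‖Φ s p‖ := by positivity
      rw [hL]; nlinarith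
    rw [hw, ← div_eq_mul_inv, le_div_iff₀ (by positivity), inv_mul_le_iff₀ (by positivity),
      mul_comm, ← mul_pow]
    exact pow_le_pow_left₀ (by positivity) h4 2
  have hYb : ∀ s ∈ Set.Icc (0 : ℝ) T, ‖iteratedFDeriv ℝ 1 Y (Φ s p)‖ +
          ‖iteratedFDeriv ℝ 2 Y (Φ s p)‖ + ‖iteratedFDeriv ℝ 3 Y (Φ s p)‖ ≤ A * w := by
    intro s hs
    have h1 := hYd (Φ s p)
    have h2 := hdisp s hs
    have hφ := norm_nonneg (Φ s p)
    rw [mul_comm, ← le_div_iff₀ (by positivity), div_eq_mul_inv] at h1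
    refine h1.trans ((mul_le_mul_of_nonneg_left h2 hC₀.le).trans (le_of_eq ?_))
    rw [hA]; ring
  obtain ⟨b1', b2, b3⟩ := var_bounds hT hAp hwp hw1 hE Y Φ hY hΦ hΦt h0 hd p hYb t ht
  have P1 : 0 ≤ 2 * Cc * L ^ 2 * T * w := by positivity
  have P2 : 0 ≤ A * E * T * w := by positivity
  have P3 : 0 ≤ (E ^ 3 + 4 * E ^ 8) * w := by positivity
  refine ⟨?_, ?_, ?_⟩
  · have hder : ∀ s ∈ Set.Icc (0 : ℝ) T, HasDerivWithinAt (fun s => ‖Φ s p‖ ^ 2 - 2 * α * s)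
        (2 * ⟪Φ s p, Y (Φ s p)⟫ - 2 * α * 1) (Set.Icc 0 T) s := fun s hs =>
      (hd p s hs).norm_sq.sub ((hasDerivWithinAt_id s _).const_mul (2 * α))
    have h1 := norm_image_sub_le_of_norm_deriv_le_segment' hder (C := 2 * (Cc * (L ^ 2 * w)))
      (fun x hx => by
        have hx' : x ∈ Set.Icc (0 : ℝ) T := ⟨hx.1, hx.2.le⟩
        have e : 2 * ⟪Φ x p, Y (Φ x p)⟫ - 2 * α * 1 = 2 * (⟪Φ x p, Y (Φ x p)⟫ - α) := by ring
        rw [e, Real.norm_eq_abs, abs_mul, abs_two]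
        have h1 := (hfb (Φ x p)).2
        have h2 := mul_le_mul_of_nonneg_left (hdisp x hx') hCp.le
        linarith) t ht
    have e : ‖Φ t p‖ ^ 2 - ‖p‖ ^ 2 - 2 * α * t =
        ‖Φ t p‖ ^ 2 - 2 * α * t - (‖Φ 0 p‖ ^ 2 - 2 * α * 0) := by rw [h0]; ring
    rw [e, ← Real.norm_eq_abs]
    refine h1.trans ?_
    have := mul_le_mul_of_nonneg_left ht.2 (by positivity : 0 ≤ 2 * (Cc * (L ^ 2 * w)))
    rw [sub_zero]
    refine this.trans ?_
    linarith
  · linarith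
  · linarith
end
end

section
/- Let n ≥ 2 and let χ, α, Y, M₀, C̃₀, ℛ₁, T and the flow Φ be as in the context. Define f(t,p) = e^{(|Φ(t,p)|² − |p|²)/4}, h(t,p) = (Φ(t,p)·Y(Φ(t,p)))² + 2|Y(Φ(t,p))|² + 2 Φ(t,p)·(∇Y(Φ(t,p))[Y(Φ(t,p))]), and, for 0 ≤ a,t ≤ T, Q₀(a,t,p) = (1/4)∫₀¹ h(a+(t−a)ρ, p) f(a+(t−a)ρ, p)(1−ρ) dρ. Then for all 0 ≤ a,t ≤ T and all p: (i) f(t,p) = f(a,p)(1 + ((t−a)/2)·Φ(a,p)·Y(Φ(a,p))) + (t−a)² Q₀(a,t,p); and there is a constant C̃₂ > 0, depending only on n, ℛ₁, M₀, C̃₀ and T, such that (ii) |Q₀(a,t,p) − (α²/4)∫₀¹ e^{(α/2)(a+(t−a)ρ)}(1−ρ)dρ| ≤ C̃₂(1+|p|)^{-2} and (iii) |∇_p Q₀(a,t,p)| ≤ C̃₂(1+|p|)^{-1}. -/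
noncomputable section

open Set Metric Real Filter
open scoped RealInnerProductSpace

/-- `f(t,p) = e^{(|Φ(t,p)|² − |p|²)/4}`. -/
def flowWeight {n : ℕ} (Φ : ℝ → Euc n → Euc n) (t : ℝ) (p : Euc n) : ℝ :=
  Real.exp ((‖Φ t p‖ ^ 2 - ‖p‖ ^ 2) / 4)

/-- `h(t,p) = (Φ·Y(Φ))² + 2|Y(Φ)|² + 2 Φ·(∇Y(Φ)[Y(Φ)])`. -/
def flowH {n : ℕ} (Y : Euc n → Euc n) (Φ : ℝ → Euc n → Euc n) (t : ℝ) (p : Euc n) : ℝ :=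
  (⟪Φ t p, Y (Φ t p)⟫) ^ 2 + 2 * ‖Y (Φ t p)‖ ^ 2 +
    2 * ⟪Φ t p, (fderiv ℝ Y (Φ t p)) (Y (Φ t p))⟫

/-- `Q₀(a,t,p) = (1/4)∫₀¹ h(a+(t−a)ρ, p) f(a+(t−a)ρ, p)(1−ρ) dρ`. -/
def flowQ {n : ℕ} (Y : Euc n → Euc n) (Φ : ℝ → Euc n → Euc n) (a t : ℝ) (p : Euc n) : ℝ :=
  (1 / 4) * ∫ ρ in (0 : ℝ)..1,
    flowH Y Φ (a + (t - a) * ρ) p * flowWeight Φ (a + (t - a) * ρ) p * (1 - ρ)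


section Helpers

variable {E : Type*} [NormedAddCommGroup E] [InnerProductSpace ℝ E]

theorem aux_Y_bound (R₁ M₀ C₀ α c : ℝ) (hR₁ : 1 < R₁) (hα : |α| ≤ M₀) (hC₀ : 0 < C₀)
    (x y : E) (hc : c ∈ Set.Icc (0 : ℝ) 1) (hc0 : ‖x‖ ≤ R₁ → c = 0)
    (h : (1 + ‖x‖) ^ 3 * ‖y - (α * c * (‖x‖ ^ 2)⁻¹) • x‖ ≤ C₀) :
    ‖y‖ * (1 + ‖x‖) ≤ 2 * M₀ + C₀ := by
  have hx := norm_nonneg x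
  have hM : 0 ≤ M₀ := (abs_nonneg _).trans hα
  set v := (α * c * (‖x‖ ^ 2)⁻¹) • x with hv
  have h1 : ‖y - v‖ * (1 + ‖x‖) ≤ C₀ := by
    refine le_trans ?_ h
    rw [mul_comm]
    gcongr
    nlinarith [mul_nonneg hx hx, mul_nonneg hx (mul_nonneg hx hx)]
  have h2 : ‖v‖ * (1 + ‖x‖) ≤ 2 * M₀ := by
    by_cases hh : ‖x‖ ≤ R₁
    · rw [hv, hc0 hh]; simp; positivity
    · push Not at hh
      have hx0 : 0 < ‖x‖ := by linarith
      have : ‖v‖ = |α| * c * ‖x‖⁻¹ := by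
        rw [hv, norm_smul, Real.norm_eq_abs, abs_mul, abs_mul, abs_of_nonneg hc.1,
          abs_of_nonneg (by positivity : 0 ≤ (‖x‖ ^ 2)⁻¹)]
        field_simp
      rw [this]
      have e1 : |α| * c ≤ M₀ := by nlinarith [hc.1, hc.2, abs_nonneg α]
      have e2 : ‖x‖⁻¹ * (1 + ‖x‖) ≤ 2 := by
        rw [inv_mul_le_iff₀ hx0]; linarith
      calc |α| * c * ‖x‖⁻¹ * (1 + ‖x‖) = (|α| * c) * (‖x‖⁻¹ * (1 + ‖x‖)) := by ring
        _ ≤ M₀ * 2 := by gcongr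
        _ = 2 * M₀ := by ring
  have h3 : ‖y‖ ≤ ‖y - v‖ + ‖v‖ := by
    simpa using norm_add_le (y - v) v
  nlinarith

theorem aux_g_bound (R₁ M₀ C₀ α c : ℝ) (hR₁ : 1 < R₁) (hα : |α| ≤ M₀) (hC₀ : 0 < C₀)
    (x y : E) (hc : c ∈ Set.Icc (0 : ℝ) 1) (hc0 : ‖x‖ ≤ R₁ → c = 0)
    (hc1 : R₁ + 1 ≤ ‖x‖ → c = 1)
    (h : (1 + ‖x‖) ^ 3 * ‖y - (α * c * (‖x‖ ^ 2)⁻¹) • x‖ ≤ C₀) :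
    |⟪x, y⟫ - α| * (1 + ‖x‖) ^ 2 ≤ C₀ + M₀ * (R₁ + 2) ^ 2 := by
  have hx := norm_nonneg x
  have hM : 0 ≤ M₀ := (abs_nonneg _).trans hα
  set v := (α * c * (‖x‖ ^ 2)⁻¹) • x with hv
  have hxv : ⟪x, v⟫ = α * c := by
    by_cases hh : ‖x‖ ≤ R₁
    · rw [hv, hc0 hh]; simp
    · push Not at hh
      have hx0 : 0 < ‖x‖ := by linarith
      rw [hv, real_inner_smul_right, real_inner_self_eq_norm_sq]
      field_simp
  have e : ⟪x, y⟫ - α = ⟪x, y - v⟫ + α * (c - 1) := by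
    rw [inner_sub_right, hxv]; ring
  have h1 : |⟪x, y - v⟫| * (1 + ‖x‖) ^ 2 ≤ C₀ := by
    refine le_trans ?_ h
    calc |⟪x, y - v⟫| * (1 + ‖x‖) ^ 2 ≤ ((1 + ‖x‖) * ‖y - v‖) * (1 + ‖x‖) ^ 2 := by
          gcongr
          refine (abs_real_inner_le_norm _ _).trans ?_
          gcongr; linarith
      _ = _ := by ring
  have h2 : |α * (c - 1)| * (1 + ‖x‖) ^ 2 ≤ M₀ * (R₁ + 2) ^ 2 := by
    by_cases hh : R₁ + 1 ≤ ‖x‖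
    · rw [hc1 hh]; simp; positivity
    · push Not at hh
      have : |α * (c - 1)| ≤ M₀ := by
        rw [abs_mul]
        have : |c - 1| ≤ 1 := by rw [abs_le]; constructor <;> linarith [hc.1, hc.2]
        nlinarith [abs_nonneg α, abs_nonneg (c - 1)]
      have h9 : 1 + ‖x‖ ≤ R₁ + 2 := by linarith
      gcongr
  rw [e]
  have h3 := abs_add_le ⟪x, y - v⟫ (α * (c - 1))
  calc _ ≤ (|⟪x, y - v⟫| + |α * (c - 1)|) * (1 + ‖x‖) ^ 2 := by gcongr
    _ ≤ _ := by linarith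

/-- the function `H` -/
def auxH (x y : E) (A : E →L[ℝ] E) : ℝ :=
  ⟪x, y⟫ ^ 2 + 2 * ‖y‖ ^ 2 + 2 * ⟪x, A y⟫

theorem aux_g_abs (B : ℝ) (x y : E) (hY : ‖y‖ * (1 + ‖x‖) ≤ B) : |⟪x, y⟫| ≤ B := by
  refine (abs_real_inner_le_norm _ _).trans ?_
  nlinarith [norm_nonneg x, norm_nonneg y]

theorem aux_H_bound (M₀ C₀ α A' B : ℝ) (hα : |α| ≤ M₀)
    (x y : E) (A : E →L[ℝ] E) (hY : ‖y‖ * (1 + ‖x‖) ≤ B)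
    (hg : |⟪x, y⟫ - α| * (1 + ‖x‖) ^ 2 ≤ A') (hA : (1 + ‖x‖) ^ 2 * ‖A‖ ≤ C₀) :
    |auxH x y A - α ^ 2| * (1 + ‖x‖) ^ 2 ≤ A' * (B + M₀) + 2 * B ^ 2 + 2 * (C₀ * B) := by
  have hx := norm_nonneg x
  have hy := norm_nonneg y
  have hga := aux_g_abs B x y hY
  set g := ⟪x, y⟫
  have hB : 0 ≤ B := (abs_nonneg _).trans hga
  have h1 : |g ^ 2 - α ^ 2| * (1 + ‖x‖) ^ 2 ≤ A' * (B + M₀) := by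
    have : g ^ 2 - α ^ 2 = (g - α) * (g + α) := by ring
    rw [this, abs_mul]
    have h3 : |g + α| ≤ B + M₀ := (abs_add_le _ _).trans (by linarith)
    calc |g - α| * |g + α| * (1 + ‖x‖) ^ 2 = (|g - α| * (1 + ‖x‖) ^ 2) * |g + α| := by ring
      _ ≤ _ := by
        have : 0 ≤ A' := le_trans (by positivity) hg
        gcongr
  have h2 : ‖y‖ ^ 2 * (1 + ‖x‖) ^ 2 ≤ B ^ 2 := by
    rw [← mul_pow]; gcongr
  have h3 : |⟪x, A y⟫| * (1 + ‖x‖) ^ 2 ≤ C₀ * B := by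
    have : |⟪x, A y⟫| ≤ (1 + ‖x‖) * (‖A‖ * ‖y‖) := by
      refine (abs_real_inner_le_norm _ _).trans ?_
      gcongr
      · linarith
      · exact A.le_opNorm y
    have hC : 0 ≤ C₀ := le_trans (by positivity) hA
    calc _ ≤ (1 + ‖x‖) * (‖A‖ * ‖y‖) * (1 + ‖x‖) ^ 2 := by gcongr
      _ = ((1 + ‖x‖) ^ 2 * ‖A‖) * (‖y‖ * (1 + ‖x‖)) := by ring
      _ ≤ _ := by gcongr
  have e : |auxH x y A - α ^ 2| ≤ |g ^ 2 - α ^ 2| + 2 * ‖y‖ ^ 2 + 2 * |⟪x, A y⟫| := by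
    have : auxH x y A - α ^ 2 = (g ^ 2 - α ^ 2) + 2 * ‖y‖ ^ 2 + 2 * ⟪x, A y⟫ := by
      unfold auxH; ring
    rw [this]
    refine (abs_add_le _ _).trans ?_
    rw [abs_mul, abs_two]
    gcongr
    refine (abs_add_le _ _).trans ?_
    rw [abs_of_nonneg (by positivity : 0 ≤ 2 * ‖y‖ ^ 2)]
  calc _ ≤ (|g ^ 2 - α ^ 2| + 2 * ‖y‖ ^ 2 + 2 * |⟪x, A y⟫|) * (1 + ‖x‖) ^ 2 := by gcongr
    _ ≤ _ := by linarith

theorem aux_g_lip (k b L d r : ℝ) (hr : 0 < r) (hd : 0 ≤ d)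
    (x x' y y' : E) (hL : 0 ≤ L)
    (hx' : ‖x'‖ * r ≤ k) (hy : ‖y‖ ≤ b * r)
    (hxx : ‖x - x'‖ ≤ d) (hyy : ‖y - y'‖ ≤ L * r ^ 2 * d) :
    |⟪x, y⟫ - ⟪x', y'⟫| ≤ (b + k * L) * d * r := by
  have e : ⟪x, y⟫ - ⟪x', y'⟫ = ⟪x - x', y⟫ + ⟪x', y - y'⟫ := by
    rw [inner_sub_left, inner_sub_right]; ring
  rw [e]
  have h1 : |⟪x - x', y⟫| ≤ d * (b * r) :=
    (abs_real_inner_le_norm _ _).trans (by gcongr)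
  have h2 : |⟪x', y - y'⟫| ≤ k * (L * r * d) := by
    calc _ ≤ ‖x'‖ * (L * r ^ 2 * d) := (abs_real_inner_le_norm _ _).trans (by gcongr)
      _ = (‖x'‖ * r) * (L * r * d) := by ring
      _ ≤ _ := by gcongr
  refine (abs_add_le _ _).trans ?_
  linarith

theorem aux_H_lip (B k b L d r : ℝ) (hr : 0 < r) (hr1 : r ≤ 1) (hd : 0 ≤ d)
    (x x' y y' : E) (A A' : E →L[ℝ] E) (hL : 0 ≤ L) (hb : 0 ≤ b)
    (hx' : ‖x'‖ * r ≤ k) (hy : ‖y‖ ≤ b * r) (hy' : ‖y'‖ ≤ b * r)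
    (hg : |⟪x, y⟫| ≤ B) (hg' : |⟪x', y'⟫| ≤ B)
    (hA : ‖A‖ ≤ L * r ^ 2) (hA' : ‖A'‖ ≤ L * r ^ 2)
    (hxx : ‖x - x'‖ ≤ d) (hyy : ‖y - y'‖ ≤ L * r ^ 2 * d) (hAA : ‖A - A'‖ ≤ L * r ^ 2 * d) :
    |auxH x y A - auxH x' y' A'| ≤
      (2 * B * (b + k * L) + 4 * b * L + 2 * (L * b + k * L * b + k * L ^ 2)) * d * r := by
  have hk : 0 ≤ k := le_trans (by positivity) hx'
  have hB : 0 ≤ B := (abs_nonneg _).trans hg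
  have h0 := aux_g_lip k b L d r hr hd x x' y y' hL hx' hy hxx hyy
  have r2 : r ^ 2 ≤ r := by nlinarith
  have r3 : r ^ 3 ≤ r := by nlinarith [mul_nonneg hr.le hr.le]
  have h1 : |⟪x, y⟫ ^ 2 - ⟪x', y'⟫ ^ 2| ≤ 2 * B * ((b + k * L) * d * r) := by
    have : ⟪x, y⟫ ^ 2 - ⟪x', y'⟫ ^ 2 = (⟪x, y⟫ + ⟪x', y'⟫) * (⟪x, y⟫ - ⟪x', y'⟫) := by ring
    rw [this, abs_mul]
    gcongr
    exact (abs_add_le _ _).trans (by linarith)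
  have h2 : |‖y‖ ^ 2 - ‖y'‖ ^ 2| ≤ 2 * b * L * d * r := by
    have : ‖y‖ ^ 2 - ‖y'‖ ^ 2 = (‖y‖ + ‖y'‖) * (‖y‖ - ‖y'‖) := by ring
    rw [this, abs_mul, abs_of_nonneg (by positivity : 0 ≤ ‖y‖ + ‖y'‖)]
    calc _ ≤ (b * r + b * r) * (L * r ^ 2 * d) := by
          gcongr
          exact (abs_norm_sub_norm_le _ _).trans hyy
      _ = 2 * b * L * d * r ^ 3 := by ring
      _ ≤ _ := by gcongr
  have e : ⟪x, A y⟫ - ⟪x', A' y'⟫ =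
      ⟪x - x', A y⟫ + ⟪x', (A - A') y⟫ + ⟪x', A' (y - y')⟫ := by
    simp only [inner_sub_left, inner_sub_right, map_sub, _root_.sub_apply]; ring
  have h3 : |⟪x - x', A y⟫| ≤ L * b * d * r := by
    calc _ ≤ d * ((L * r ^ 2) * (b * r)) := (abs_real_inner_le_norm _ _).trans (by
            gcongr
            exact (A.le_opNorm y).trans (by gcongr))
      _ = L * b * d * r ^ 3 := by ring
      _ ≤ _ := by gcongr
  have h4 : |⟪x', (A - A') y⟫| ≤ k * L * b * d * r := by
    calc _ ≤ ‖x'‖ * ((L * r ^ 2 * d) * (b * r)) := (abs_real_inner_le_norm _ _).trans (by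
            gcongr
            exact ((A - A').le_opNorm y).trans (by gcongr))
      _ = (‖x'‖ * r) * (L * b * d * r ^ 2) := by ring
      _ ≤ k * (L * b * d * r) := by gcongr
      _ = _ := by ring
  have h5 : |⟪x', A' (y - y')⟫| ≤ k * L ^ 2 * d * r := by
    calc _ ≤ ‖x'‖ * ((L * r ^ 2) * (L * r ^ 2 * d)) := (abs_real_inner_le_norm _ _).trans (by
            gcongr
            exact (A'.le_opNorm _).trans (by gcongr))
      _ = (‖x'‖ * r) * (L ^ 2 * d * r ^ 3) := by ring
      _ ≤ k * (L ^ 2 * d * r) := by gcongr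
      _ = _ := by ring
  have e2 : auxH x y A - auxH x' y' A' = (⟪x, y⟫ ^ 2 - ⟪x', y'⟫ ^ 2) +
      2 * (‖y‖ ^ 2 - ‖y'‖ ^ 2) + 2 * (⟪x - x', A y⟫ + ⟪x', (A - A') y⟫ + ⟪x', A' (y - y')⟫) := by
    rw [← e]; unfold auxH; ring
  rw [e2]
  rw [abs_le] at *
  constructor <;> linarith [h1.1, h1.2, h2.1, h2.2, h3.1, h3.2, h4.1, h4.2, h5.1, h5.2]

theorem aux_exp_lip (K u v : ℝ) (hu : u ≤ K) (hv : v ≤ K) :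
    |Real.exp u - Real.exp v| ≤ Real.exp K * |u - v| := by
  have key : ∀ u v : ℝ, u ≤ K → v ≤ u → Real.exp u - Real.exp v ≤ Real.exp K * (u - v) := by
    intro u v hu hvu
    have h1 : Real.exp v = Real.exp u * Real.exp (v - u) := by rw [← Real.exp_add]; ring_nf
    have h2 := Real.add_one_le_exp (v - u)
    have h3 : Real.exp u ≤ Real.exp K := Real.exp_le_exp.2 hu
    have h4 := Real.exp_pos u
    have h5 : Real.exp u * (v - u + 1) ≤ Real.exp u * Real.exp (v - u) := by gcongr
    have h6 : Real.exp u * (u - v) ≤ Real.exp K * (u - v) := by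
      have : 0 ≤ u - v := by linarith
      gcongr
    rw [h1]; nlinarith
  rcases le_total v u with h | h
  · rw [abs_of_nonneg (sub_nonneg.2 (Real.exp_le_exp.2 h)), abs_of_nonneg (sub_nonneg.2 h)]
    exact key u v hu h
  · rw [abs_sub_comm, abs_sub_comm u v, abs_of_nonneg (sub_nonneg.2 (Real.exp_le_exp.2 h)),
      abs_of_nonneg (sub_nonneg.2 h)]
    exact key v u hv h

/-- derivative bound on `[0,T]` -/
theorem aux_mvt {F : Type*} [NormedAddCommGroup F] [NormedSpace ℝ F] (T C : ℝ) (φ φ' : ℝ → F)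
    (h : ∀ s ∈ Set.Icc (0 : ℝ) T, HasDerivWithinAt φ (φ' s) (Set.Icc (0 : ℝ) T) s)
    (hb : ∀ s ∈ Set.Icc (0 : ℝ) T, ‖φ' s‖ ≤ C) (hC : 0 ≤ C) :
    ∀ s ∈ Set.Icc (0 : ℝ) T, ‖φ s - φ 0‖ ≤ C * T := by
  intro s hs
  have := norm_image_sub_le_of_norm_deriv_le_segment' (f := φ) (f' := φ') (C := C) h
    (fun x hx => hb x (Set.Ico_subset_Icc_self hx)) s hs
  refine this.trans ?_
  gcongr
  linarith [hs.2]

theorem aux_taylor (T a t : ℝ) (ha : a ∈ Set.Icc (0 : ℝ) T) (ht : t ∈ Set.Icc (0 : ℝ) T)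
    (F F' F'' : ℝ → ℝ)
    (h1 : ∀ s ∈ Set.Icc (0 : ℝ) T, HasDerivWithinAt F (F' s) (Set.Icc (0 : ℝ) T) s)
    (h2 : ∀ s ∈ Set.Icc (0 : ℝ) T, HasDerivWithinAt F' (F'' s) (Set.Icc (0 : ℝ) T) s)
    (hγ : ∀ ρ ∈ Set.Icc (0 : ℝ) 1, a + (t - a) * ρ ∈ Set.Icc (0 : ℝ) T)
    (hint : IntervalIntegrable (fun ρ => F'' (a + (t - a) * ρ) * (1 - ρ))
      MeasureTheory.volume 0 1) :
    F t = F a + (t - a) * F' a + (t - a) ^ 2 *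
      ∫ ρ in (0 : ℝ)..1, F'' (a + (t - a) * ρ) * (1 - ρ) := by
  set γ : ℝ → ℝ := fun ρ => a + (t - a) * ρ with hγd
  have hγ' : ∀ ρ, HasDerivWithinAt γ (t - a) (Set.Icc (0 : ℝ) 1) ρ := by
    intro ρ
    have := ((hasDerivAt_id ρ).const_mul (t - a)).const_add a
    simpa [hγd] using this.hasDerivWithinAt
  have hG : ∀ ρ ∈ Set.Icc (0 : ℝ) 1, HasDerivWithinAt
      (fun ρ => F (γ ρ) + (t - a) * ((1 - ρ) * F' (γ ρ)))
      ((t - a) ^ 2 * (F'' (γ ρ) * (1 - ρ))) (Set.Icc (0 : ℝ) 1) ρ := by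
    intro ρ hρ
    have d1 := (h1 _ (hγ ρ hρ)).comp ρ (hγ' ρ) hγ
    have d2 := (h2 _ (hγ ρ hρ)).comp ρ (hγ' ρ) hγ
    have d3 : HasDerivWithinAt (fun ρ : ℝ => 1 - ρ) (-1) (Set.Icc (0 : ℝ) 1) ρ := by
      simpa using ((hasDerivAt_id ρ).const_sub 1).hasDerivWithinAt
    have d4 := d1.add ((d3.mul d2).const_mul (t - a))
    refine d4.congr_deriv ?_
    simp only [Function.comp]
    ring
  have := intervalIntegral.integral_eq_sub_of_hasDerivAt_of_le (a := (0 : ℝ)) (b := 1)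
    (f := fun ρ => F (γ ρ) + (t - a) * ((1 - ρ) * F' (γ ρ)))
    (f' := fun ρ => (t - a) ^ 2 * (F'' (γ ρ) * (1 - ρ))) zero_le_one
    (fun ρ hρ => (hG ρ hρ).continuousWithinAt)
    (fun ρ hρ => (hG ρ (Set.Ioo_subset_Icc_self hρ)).hasDerivAt (Icc_mem_nhds hρ.1 hρ.2))
    (hint.const_mul _)
  rw [intervalIntegral.integral_const_mul] at this
  rw [this]
  simp [hγd]

theorem aux_weight (D : ℝ) (hD : 0 ≤ D) (x p : E) (h : ‖x - p‖ ≤ D) :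
    (1 + ‖x‖)⁻¹ ≤ (1 + D) * (1 + ‖p‖)⁻¹ ∧ ‖x‖ * (1 + ‖p‖)⁻¹ ≤ 1 + D := by
  have hx := norm_nonneg x
  have hp := norm_nonneg p
  have h1 : ‖p‖ ≤ ‖x‖ + D := by
    have := norm_sub_norm_le p x
    rw [norm_sub_rev] at this; linarith
  have h2 : ‖x‖ ≤ ‖p‖ + D := by
    have := norm_sub_norm_le x p
    linarith
  constructor
  · rw [← div_eq_mul_inv, inv_eq_one_div, div_le_div_iff₀ (by positivity) (by positivity)]
    nlinarith
  · rw [← div_eq_mul_inv, div_le_iff₀ (by positivity)]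
    nlinarith

/-- hypotheses on the vector field and the flow -/
structure AuxFlow (M₀ C₀ A B T α : ℝ) (Y : E → E) (Φ : ℝ → E → E) : Prop where
  hC : 0 < C₀
  hB : 0 < B
  hT : 0 < T
  hα : |α| ≤ M₀
  hY : ContDiff ℝ 2 Y
  hYb : ∀ x, ‖Y x‖ * (1 + ‖x‖) ≤ B
  hg : ∀ x, |⟪x, Y x⟫ - α| * (1 + ‖x‖) ^ 2 ≤ A
  hD1 : ∀ x, (1 + ‖x‖) ^ 2 * ‖fderiv ℝ Y x‖ ≤ C₀
  hD2 : ∀ x, (1 + ‖x‖) ^ 2 * ‖fderiv ℝ (fderiv ℝ Y) x‖ ≤ C₀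
  h0 : ∀ p, Φ 0 p = p
  hΦ : ∀ p, ∀ t ∈ Set.Icc (0 : ℝ) T,
          HasDerivWithinAt (fun s => Φ s p) (Y (Φ t p)) (Set.Icc (0 : ℝ) T) t

/-- exponent -/
def auxE (Φ : ℝ → E → E) (s : ℝ) (p : E) : ℝ := (‖Φ s p‖ ^ 2 - ‖p‖ ^ 2) / 4

namespace AuxFlow

variable {M₀ C₀ A B T α : ℝ} {Y : E → E} {Φ : ℝ → E → E}

theorem le_of_sq (c : ℝ) (D : ℝ) (hD : 0 ≤ D) (x p : E) (h : ‖x - p‖ ≤ D) (v : ℝ) (hc : 0 ≤ c)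
    (hv : (1 + ‖x‖) ^ 2 * v ≤ c) : v ≤ c * (1 + D) ^ 2 * ((1 + ‖p‖)⁻¹) ^ 2 := by
  have h1 := (aux_weight D hD x p h).1
  have hx := norm_nonneg x
  have : v ≤ c * ((1 + ‖x‖)⁻¹) ^ 2 := by
    rw [inv_pow, ← div_eq_mul_inv, le_div_iff₀ (by positivity)]; linarith
  refine this.trans ?_
  rw [mul_assoc, ← mul_pow]
  gcongr

theorem Yb (F : AuxFlow M₀ C₀ A B T α Y Φ) (x : E) : ‖Y x‖ ≤ B := by
  have := F.hYb x
  nlinarith [norm_nonneg x, norm_nonneg (Y x)]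

theorem disp (F : AuxFlow M₀ C₀ A B T α Y Φ) (p : E) (s : ℝ) (hs : s ∈ Set.Icc (0 : ℝ) T) :
    ‖Φ s p - p‖ ≤ B * T := by
  have := aux_mvt T B (fun s => Φ s p) (fun s => Y (Φ s p)) (F.hΦ p) (fun s _ => F.Yb _) F.hB.le s hs
  simpa [F.h0] using this

theorem Eder (F : AuxFlow M₀ C₀ A B T α Y Φ) (p : E) (s : ℝ) (hs : s ∈ Set.Icc (0 : ℝ) T) :
    HasDerivWithinAt (fun s => auxE Φ s p) ((1 / 2) * ⟪Φ s p, Y (Φ s p)⟫)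
      (Set.Icc (0 : ℝ) T) s := by
  have h := (((F.hΦ p s hs).norm_sq).sub_const (‖p‖ ^ 2)).div_const 4
  refine h.congr_deriv ?_
  ring

theorem E0 (F : AuxFlow M₀ C₀ A B T α Y Φ) (p : E) : auxE Φ 0 p = 0 := by
  simp [auxE, F.h0]

theorem Eb (F : AuxFlow M₀ C₀ A B T α Y Φ) (p : E) (s : ℝ) (hs : s ∈ Set.Icc (0 : ℝ) T) :
    |auxE Φ s p| ≤ B * T := by
  have := aux_mvt T B (fun s => auxE Φ s p) _ (F.Eder p) (fun s _ => by
    have := aux_g_abs B _ _ (F.hYb (Φ s p))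
    rw [norm_mul, Real.norm_eq_abs, Real.norm_eq_abs, abs_of_pos (by norm_num : (0 : ℝ) < 1 / 2)]
    linarith [abs_nonneg ⟪Φ s p, Y (Φ s p)⟫]) F.hB.le s hs
  simpa [F.E0] using this

theorem hA (F : AuxFlow M₀ C₀ A B T α Y Φ) : 0 ≤ A := le_trans (by positivity) (F.hg 0)

theorem Eα (F : AuxFlow M₀ C₀ A B T α Y Φ) (p : E) (s : ℝ) (hs : s ∈ Set.Icc (0 : ℝ) T) :
    |auxE Φ s p - α / 2 * s| ≤ A * (1 + B * T) ^ 2 * ((1 + ‖p‖)⁻¹) ^ 2 * T := by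
  have hA := F.hA
  have hB := F.hB
  have hT := F.hT
  have := aux_mvt T (A * (1 + B * T) ^ 2 * ((1 + ‖p‖)⁻¹) ^ 2) (fun s => auxE Φ s p - α / 2 * s)
    (fun s => (1 / 2) * ⟪Φ s p, Y (Φ s p)⟫ - α / 2) (fun s hs => by
      have h2 : HasDerivWithinAt (fun s : ℝ => α / 2 * s) (α / 2) (Set.Icc (0 : ℝ) T) s := by
        simpa using ((hasDerivAt_id s).const_mul (α / 2)).hasDerivWithinAt
      exact (F.Eder p s hs).sub h2) (fun s hs => by
    have h1 := F.hg (Φ s p)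
    rw [mul_comm] at h1
    have h2 := le_of_sq A (B * T) (by positivity) _ p (F.disp p s hs) _ hA h1
    have e : (1 / 2) * ⟪Φ s p, Y (Φ s p)⟫ - α / 2 = (1 / 2) * (⟪Φ s p, Y (Φ s p)⟫ - α) := by ring
    rw [e, norm_mul, Real.norm_eq_abs, Real.norm_eq_abs,
      abs_of_pos (by norm_num : (0 : ℝ) < 1 / 2)]
    linarith [abs_nonneg (⟪Φ s p, Y (Φ s p)⟫ - α)]) (by positivity) s hs
  simpa [F.E0] using this

theorem gron (F : AuxFlow M₀ C₀ A B T α Y Φ) (p q : E) (s : ℝ) (hs : s ∈ Set.Icc (0 : ℝ) T) :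
    ‖Φ s q - Φ s p‖ ≤ Real.exp (C₀ * T) * ‖q - p‖ := by
  have hlip : LipschitzWith C₀.toNNReal Y := by
    refine lipschitzWith_of_nnnorm_fderiv_le (𝕜 := ℝ) (F.hY.differentiable (by norm_num)) ?_
    intro x
    rw [← NNReal.coe_le_coe, Real.coe_toNNReal _ F.hC.le, coe_nnnorm]
    have := F.hD1 x
    have hx := norm_nonneg x
    have : 1 * ‖fderiv ℝ Y x‖ ≤ (1 + ‖x‖) ^ 2 * ‖fderiv ℝ Y x‖ := by
      gcongr; nlinarith
    linarith
  have key : ∀ p, ∀ t ∈ Set.Ico (0 : ℝ) T,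
      HasDerivWithinAt (fun s => Φ s p) (Y (Φ t p)) (Set.Ici t) t := fun p t ht =>
    (F.hΦ p t (Set.Ico_subset_Icc_self ht)).mono_of_mem_nhdsWithin (Icc_mem_nhdsGE_of_mem ht)
  have := dist_le_of_trajectories_ODE (v := fun _ => Y) (K := C₀.toNNReal) (fun _ => hlip)
    (f := fun s => Φ s q) (g := fun s => Φ s p) (a := 0) (b := T) (δ := ‖q - p‖)
    (fun t ht => (F.hΦ q t ht).continuousWithinAt) (key q)
    (fun t ht => (F.hΦ p t ht).continuousWithinAt) (key p)
    (by simp [F.h0, dist_eq_norm]) s hs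
  rw [dist_eq_norm, Real.coe_toNNReal _ F.hC.le, sub_zero] at this
  refine this.trans ?_
  rw [mul_comm]
  have hC := F.hC
  have hs2 := hs.2
  gcongr

/-- the composite -/
def HH (Y : E → E) (Φ : ℝ → E → E) (s : ℝ) (p : E) : ℝ :=
  auxH (Φ s p) (Y (Φ s p)) (fderiv ℝ Y (Φ s p))

theorem local_lip (F : AuxFlow M₀ C₀ A B T α Y Φ) (p x x' : E) (D : ℝ) (hD : 0 ≤ D)
    (hx : ‖x - p‖ ≤ D) (hx' : ‖x' - p‖ ≤ D) :
    ‖Y x - Y x'‖ ≤ C₀ * (1 + D) ^ 2 * ((1 + ‖p‖)⁻¹) ^ 2 * ‖x - x'‖ ∧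
    ‖fderiv ℝ Y x - fderiv ℝ Y x'‖ ≤ C₀ * (1 + D) ^ 2 * ((1 + ‖p‖)⁻¹) ^ 2 * ‖x - x'‖ := by
  have hc := convex_closedBall p D
  have m : x ∈ Metric.closedBall p D := by simpa [dist_eq_norm] using hx
  have m' : x' ∈ Metric.closedBall p D := by simpa [dist_eq_norm] using hx'
  have dY : Differentiable ℝ Y := F.hY.differentiable (by norm_num)
  have dY' : Differentiable ℝ (fderiv ℝ Y) :=
    (F.hY.fderiv_right (m := 1) (by norm_num)).differentiable (by norm_num)
  constructor
  · exact hc.norm_image_sub_le_of_norm_fderiv_le (𝕜 := ℝ) (fun z _ => dY z) (fun z hz =>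
      le_of_sq C₀ D hD z p (by simpa [dist_eq_norm] using hz) _ F.hC.le (F.hD1 z)) m' m
  · exact hc.norm_image_sub_le_of_norm_fderiv_le (𝕜 := ℝ) (fun z _ => dY' z) (fun z hz =>
      le_of_sq C₀ D hD z p (by simpa [dist_eq_norm] using hz) _ F.hC.le (F.hD2 z)) m' m

theorem pt_lip (F : AuxFlow M₀ C₀ A B T α Y Φ) (D b k L d r : ℝ) (hD : D = B * T + 1)
    (hk : k = 1 + D) (hb : b = B * k) (hL : L = C₀ * k ^ 2)
    (p q : E) (hq : ‖q - p‖ ≤ 1) (hd : d = Real.exp (C₀ * T) * ‖q - p‖) (hr : r = (1 + ‖p‖)⁻¹)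
    (s : ℝ) (hs : s ∈ Set.Icc (0 : ℝ) T) :
    |⟪Φ s q, Y (Φ s q)⟫ - ⟪Φ s p, Y (Φ s p)⟫| ≤ (b + k * L) * d * r ∧
    |HH Y Φ s q - HH Y Φ s p| ≤
      (2 * B * (b + k * L) + 4 * b * L + 2 * (L * b + k * L * b + k * L ^ 2)) * d * r := by
  have hB := F.hB
  have hT := F.hT
  have hC := F.hC
  have hD0 : 0 ≤ D := by rw [hD]; positivity
  have hp := norm_nonneg p
  have hr0 : 0 < r := by rw [hr]; positivity
  have hr1 : r ≤ 1 := by rw [hr]; exact inv_le_one_of_one_le₀ (by linarith)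
  have hd0 : 0 ≤ d := by rw [hd]; positivity
  have hk0 : 0 ≤ k := by rw [hk]; positivity
  have hb0 : 0 ≤ b := by rw [hb]; positivity
  have hL0 : 0 ≤ L := by rw [hL]; positivity
  have hx' : ‖Φ s p - p‖ ≤ D := (F.disp p s hs).trans (by linarith)
  have hx : ‖Φ s q - p‖ ≤ D := by
    have h1 := F.disp q s hs
    have h2 := norm_add_le (Φ s q - q) (q - p)
    rw [sub_add_sub_cancel] at h2
    linarith
  have hdd : ‖Φ s q - Φ s p‖ ≤ d := by rw [hd]; exact F.gron p q s hs
  obtain ⟨l1, l2⟩ := F.local_lip p _ _ D hD0 hx hx'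
  rw [← hr, ← hk, ← hL] at l1 l2
  have l1' : ‖Y (Φ s q) - Y (Φ s p)‖ ≤ L * r ^ 2 * d := l1.trans (by gcongr)
  have l2' : ‖fderiv ℝ Y (Φ s q) - fderiv ℝ Y (Φ s p)‖ ≤ L * r ^ 2 * d := l2.trans (by gcongr)
  have yb : ∀ x, ‖x - p‖ ≤ D → ‖Y x‖ ≤ b * r := by
    intro x hx
    have h1 := (aux_weight D hD0 x p hx).1
    have h2 := F.hYb x
    have : ‖Y x‖ ≤ B * (1 + ‖x‖)⁻¹ := by
      rw [← div_eq_mul_inv, le_div_iff₀ (by positivity)]; exact h2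
    refine this.trans ?_
    rw [hb, hr, hk, mul_assoc]
    gcongr
  have ab : ∀ x, ‖x - p‖ ≤ D → ‖fderiv ℝ Y x‖ ≤ L * r ^ 2 := by
    intro x hx
    have := le_of_sq C₀ D hD0 x p hx _ F.hC.le (F.hD1 x)
    rwa [hL, hr, hk]
  have w : ‖Φ s p‖ * r ≤ k := by rw [hr, hk]; exact (aux_weight D hD0 _ p hx').2
  constructor
  · exact aux_g_lip k b L d r hr0 hd0 _ _ _ _ hL0 w (yb _ hx) hdd l1'
  · exact aux_H_lip B k b L d r hr0 hr1 hd0 _ _ _ _ _ _ hL0 hb0 w (yb _ hx) (yb _ hx')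
      (aux_g_abs B _ _ (F.hYb _)) (aux_g_abs B _ _ (F.hYb _)) (ab _ hx) (ab _ hx') hdd l1' l2'

theorem E_lip (F : AuxFlow M₀ C₀ A B T α Y Φ) (D b k L d r : ℝ) (hD : D = B * T + 1)
    (hk : k = 1 + D) (hb : b = B * k) (hL : L = C₀ * k ^ 2)
    (p q : E) (hq : ‖q - p‖ ≤ 1) (hd : d = Real.exp (C₀ * T) * ‖q - p‖) (hr : r = (1 + ‖p‖)⁻¹)
    (s : ℝ) (hs : s ∈ Set.Icc (0 : ℝ) T) :
    |auxE Φ s q - auxE Φ s p| ≤ (b + k * L) * d * r * T := by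
  have key := fun s hs => (F.pt_lip D b k L d r hD hk hb hL p q hq hd hr s hs).1
  have h0 : 0 ≤ (b + k * L) * d * r :=
    (abs_nonneg _).trans (key 0 ⟨le_rfl, F.hT.le⟩)
  have := aux_mvt T ((b + k * L) * d * r) (fun s => auxE Φ s q - auxE Φ s p) _
    (fun s hs => (F.Eder q s hs).sub (F.Eder p s hs)) (fun s hs => by
      rw [← mul_sub, norm_mul, Real.norm_eq_abs, Real.norm_eq_abs,
        abs_of_pos (by norm_num : (0 : ℝ) < 1 / 2)]
      linarith [key s hs, abs_nonneg (⟪Φ s q, Y (Φ s q)⟫ - ⟪Φ s p, Y (Φ s p)⟫)]) h0 s hs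
  simpa [F.E0] using this

theorem H_near (F : AuxFlow M₀ C₀ A B T α Y Φ) (p : E)
    (s : ℝ) (hs : s ∈ Set.Icc (0 : ℝ) T) :
    |HH Y Φ s p - α ^ 2| ≤ (A * (B + M₀) + 2 * B ^ 2 + 2 * (C₀ * B)) * (1 + B * T) ^ 2 *
      ((1 + ‖p‖)⁻¹) ^ 2 := by
  have h := aux_H_bound M₀ C₀ α A B F.hα _ _ _ (F.hYb (Φ s p)) (F.hg _) (F.hD1 _)
  have hB := F.hB
  have hT := F.hT
  rw [mul_comm] at h
  exact le_of_sq _ (B * T) (by positivity) _ p (F.disp p s hs) _ (le_trans (by positivity) h) h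

theorem final_near (F : AuxFlow M₀ C₀ A B T α Y Φ) (p : E)
    (s : ℝ) (hs : s ∈ Set.Icc (0 : ℝ) T) :
    |HH Y Φ s p * Real.exp (auxE Φ s p) - α ^ 2 * Real.exp (α / 2 * s)| ≤
      ((A * (B + M₀) + 2 * B ^ 2 + 2 * (C₀ * B)) * (1 + B * T) ^ 2 * Real.exp (B * T + M₀ * T)
      + M₀ ^ 2 * (Real.exp (B * T + M₀ * T) * (A * (1 + B * T) ^ 2 * T)))
       * ((1 + ‖p‖)⁻¹) ^ 2 := by
  have hB := F.hB
  have hT := F.hT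
  have hM : 0 ≤ M₀ := (abs_nonneg _).trans F.hα
  have h1 := F.H_near p s hs
  have h2 := F.Eα p s hs
  have h3 : auxE Φ s p ≤ B * T + M₀ * T := by
    have := (le_abs_self _).trans (F.Eb p s hs)
    nlinarith
  have h4 : α / 2 * s ≤ B * T + M₀ * T := by
    have a1 : α ≤ M₀ := (le_abs_self _).trans F.hα
    have a2 : α * s ≤ M₀ * s := mul_le_mul_of_nonneg_right a1 hs.1
    have a3 : M₀ * s ≤ M₀ * T := mul_le_mul_of_nonneg_left hs.2 hM
    have a4 : 0 ≤ B * T := by positivity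
    have a5 : 0 ≤ M₀ * T := by positivity
    linarith
  have h5 := aux_exp_lip _ _ _ h3 h4
  have h6 : Real.exp (auxE Φ s p) ≤ Real.exp (B * T + M₀ * T) := Real.exp_le_exp.2 h3
  have h7 : α ^ 2 ≤ M₀ ^ 2 := by rw [← sq_abs]; gcongr; exact F.hα
  have e : HH Y Φ s p * Real.exp (auxE Φ s p) - α ^ 2 * Real.exp (α / 2 * s) =
    (HH Y Φ s p - α ^ 2) * Real.exp (auxE Φ s p) +
      α ^ 2 * (Real.exp (auxE Φ s p) - Real.exp (α / 2 * s)) := by ring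
  rw [e]
  refine (abs_add_le _ _).trans ?_
  rw [abs_mul, abs_mul, abs_of_nonneg (sq_nonneg α), abs_of_pos (Real.exp_pos _)]
  calc _ ≤ ((A * (B + M₀) + 2 * B ^ 2 + 2 * (C₀ * B)) * (1 + B * T) ^ 2 *
      ((1 + ‖p‖)⁻¹) ^ 2) * Real.exp (B * T + M₀ * T) + M₀ ^ 2 * (Real.exp (B * T + M₀ * T) *
      (A * (1 + B * T) ^ 2 * ((1 + ‖p‖)⁻¹) ^ 2 * T)) := by
        gcongr
        · exact (abs_nonneg _).trans h1
        · exact h5.trans (by gcongr)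
    _ = _ := by ring

/-- bound for H -/
def cH (M₀ C₀ A B T : ℝ) : ℝ :=
  M₀ ^ 2 + (A * (B + M₀) + 2 * B ^ 2 + 2 * (C₀ * B)) * (1 + B * T) ^ 2

theorem H_abs (F : AuxFlow M₀ C₀ A B T α Y Φ) (p : E)
    (s : ℝ) (hs : s ∈ Set.Icc (0 : ℝ) T) : |HH Y Φ s p| ≤ cH M₀ C₀ A B T := by
  have h1 := F.H_near p s hs
  have hA := F.hA
  have hB := F.hB
  have hC := F.hC
  have hM : 0 ≤ M₀ := (abs_nonneg _).trans F.hα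
  have h7 : α ^ 2 ≤ M₀ ^ 2 := by rw [← sq_abs]; gcongr; exact F.hα
  have hr1 : ((1 + ‖p‖)⁻¹) ^ 2 ≤ 1 := by
    have hp := norm_nonneg p
    exact pow_le_one₀ (by positivity) (inv_le_one_of_one_le₀ (by linarith))
  have h8 : (A * (B + M₀) + 2 * B ^ 2 + 2 * (C₀ * B)) * (1 + B * T) ^ 2 *
      ((1 + ‖p‖)⁻¹) ^ 2 ≤ (A * (B + M₀) + 2 * B ^ 2 + 2 * (C₀ * B)) * (1 + B * T) ^ 2 * 1 := by
    gcongr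
  have h9 := abs_add_le (HH Y Φ s p - α ^ 2) (α ^ 2)
  rw [sub_add_cancel, abs_of_nonneg (sq_nonneg α)] at h9
  unfold cH
  linarith

theorem final_lip (F : AuxFlow M₀ C₀ A B T α Y Φ) (D b k L : ℝ) (hD : D = B * T + 1)
    (hk : k = 1 + D) (hb : b = B * k) (hL : L = C₀ * k ^ 2)
    (p q : E) (hq : ‖q - p‖ ≤ 1)
    (s : ℝ) (hs : s ∈ Set.Icc (0 : ℝ) T) :
    |HH Y Φ s q * Real.exp (auxE Φ s q) - HH Y Φ s p * Real.exp (auxE Φ s p)| ≤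
      ((2 * B * (b + k * L) + 4 * b * L + 2 * (L * b + k * L * b + k * L ^ 2)) *
        Real.exp (C₀ * T) * Real.exp (B * T) +
        cH M₀ C₀ A B T * (Real.exp (B * T) * ((b + k * L) * Real.exp (C₀ * T) * T)))
       * (1 + ‖p‖)⁻¹ * ‖q - p‖ := by
  have h1 := (F.pt_lip D b k L _ _ hD hk hb hL p q hq rfl rfl s hs).2
  have h2 := F.E_lip D b k L _ _ hD hk hb hL p q hq rfl rfl s hs
  have h3 := (le_abs_self _).trans (F.Eb p s hs)
  have h4 := (le_abs_self _).trans (F.Eb q s hs)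
  have h5 := aux_exp_lip _ _ _ h4 h3
  have h6 : Real.exp (auxE Φ s q) ≤ Real.exp (B * T) := Real.exp_le_exp.2 h4
  have h7 := F.H_abs p s hs
  have e : HH Y Φ s q * Real.exp (auxE Φ s q) - HH Y Φ s p * Real.exp (auxE Φ s p) =
    (HH Y Φ s q - HH Y Φ s p) * Real.exp (auxE Φ s q) +
      HH Y Φ s p * (Real.exp (auxE Φ s q) - Real.exp (auxE Φ s p)) := by ring
  rw [e]
  refine (abs_add_le _ _).trans ?_
  rw [abs_mul, abs_mul, abs_of_pos (Real.exp_pos _)]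
  calc _ ≤ ((2 * B * (b + k * L) + 4 * b * L + 2 * (L * b + k * L * b + k * L ^ 2)) *
        (Real.exp (C₀ * T) * ‖q - p‖) * (1 + ‖p‖)⁻¹) * Real.exp (B * T) +
        cH M₀ C₀ A B T * (Real.exp (B * T) *
          ((b + k * L) * (Real.exp (C₀ * T) * ‖q - p‖) * (1 + ‖p‖)⁻¹ * T)) := by
        gcongr
        · exact (abs_nonneg _).trans h1
        · exact (abs_nonneg _).trans h7
        · exact h5.trans (by gcongr)
    _ = _ := by ring

theorem taylor (F : AuxFlow M₀ C₀ A B T α Y Φ) (a t : ℝ) (ha : a ∈ Set.Icc (0 : ℝ) T)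
    (ht : t ∈ Set.Icc (0 : ℝ) T) (p : E)
    (hγ : ∀ ρ ∈ Set.Icc (0 : ℝ) 1, a + (t - a) * ρ ∈ Set.Icc (0 : ℝ) T) :
    IntervalIntegrable (fun ρ => HH Y Φ (a + (t - a) * ρ) p *
      Real.exp (auxE Φ (a + (t - a) * ρ) p) * (1 - ρ)) MeasureTheory.volume 0 1 ∧
    Real.exp (auxE Φ t p) = Real.exp (auxE Φ a p) * (1 + ((t - a) / 2) * ⟪Φ a p, Y (Φ a p)⟫) +
      (t - a) ^ 2 * ((1 / 4) * ∫ ρ in (0 : ℝ)..1, HH Y Φ (a + (t - a) * ρ) p *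
        Real.exp (auxE Φ (a + (t - a) * ρ) p) * (1 - ρ)) := by
  have cΦ : ContinuousOn (fun s => Φ s p) (Set.Icc 0 T) :=
    fun s hs => (F.hΦ p s hs).continuousWithinAt
  have cE : ContinuousOn (fun s => auxE Φ s p) (Set.Icc 0 T) :=
    fun s hs => (F.Eder p s hs).continuousWithinAt
  have cY : Continuous Y := F.hY.continuous
  have cY' : Continuous (fderiv ℝ Y) := F.hY.continuous_fderiv (by norm_num)
  have cA : Continuous (fun x : E => auxH x (Y x) (fderiv ℝ Y x)) := by
    unfold auxH
    have := cY'.clm_apply cY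
    fun_prop
  have cH : ContinuousOn (fun s => HH Y Φ s p) (Set.Icc 0 T) := cA.comp_continuousOn cΦ
  have cγ : ContinuousOn (fun ρ : ℝ => a + (t - a) * ρ) (Set.Icc 0 1) := by fun_prop
  have hint : IntervalIntegrable (fun ρ => HH Y Φ (a + (t - a) * ρ) p *
      Real.exp (auxE Φ (a + (t - a) * ρ) p) * (1 - ρ)) MeasureTheory.volume 0 1 := by
    apply ContinuousOn.intervalIntegrable
    rw [Set.uIcc_of_le zero_le_one]
    have c1 := cH.comp cγ hγ
    have c2 := (cE.comp cγ hγ).rexp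
    exact (c1.mul c2).mul (by fun_prop)
  refine ⟨hint, ?_⟩
  have d1 : ∀ s ∈ Set.Icc (0 : ℝ) T, HasDerivWithinAt (fun s => Real.exp (auxE Φ s p))
      (Real.exp (auxE Φ s p) * ((1 / 2) * ⟪Φ s p, Y (Φ s p)⟫)) (Set.Icc (0 : ℝ) T) s :=
    fun s hs => (F.Eder p s hs).exp
  have d2 : ∀ s ∈ Set.Icc (0 : ℝ) T, HasDerivWithinAt
      (fun s => Real.exp (auxE Φ s p) * ((1 / 2) * ⟪Φ s p, Y (Φ s p)⟫))
      ((1 / 4) * (HH Y Φ s p * Real.exp (auxE Φ s p))) (Set.Icc (0 : ℝ) T) s := by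
    intro s hs
    have dY : HasFDerivAt Y (fderiv ℝ Y (Φ s p)) (Φ s p) :=
      (F.hY.differentiable (by norm_num) _).hasFDerivAt
    have e1 := dY.comp_hasDerivWithinAt s (F.hΦ p s hs)
    have e2 := ((F.hΦ p s hs).inner ℝ e1).const_mul (1 / 2)
    refine ((d1 s hs).mul e2).congr_deriv ?_
    simp only [HH, auxH, Function.comp, real_inner_self_eq_norm_sq]
    ring
  have e : (fun ρ => (1 / 4) * (HH Y Φ (a + (t - a) * ρ) p *
      Real.exp (auxE Φ (a + (t - a) * ρ) p)) * (1 - ρ)) = fun ρ => (1 / 4) *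
      (HH Y Φ (a + (t - a) * ρ) p * Real.exp (auxE Φ (a + (t - a) * ρ) p) * (1 - ρ)) := by
    funext ρ; ring
  have := aux_taylor T a t ha ht _ _ _ d1 d2 hγ (by
    rw [e]; exact hint.const_mul _)
  rw [e, intervalIntegral.integral_const_mul] at this
  rw [this]
  ring

end AuxFlow

end Helpers

set_option maxHeartbeats 1000000 in
/-- Taylor expansion of the weight `e^{(|Φ|²−|p|²)/4}` along the flow,
with remainder estimates; cf. Corollary A.3 in Bernstein–Wang. -/
theorem flow_weight_taylor
    (n : ℕ) (hn : 2 ≤ n) (R₁ M₀ C₀ T : ℝ)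
    (hR₁ : 1 < R₁) (hM₀ : 0 < M₀) (hC₀ : 0 < C₀) (hT : 0 < T) :
    ∃ C₂ : ℝ, 0 < C₂ ∧
      ∀ (χ : Euc n → ℝ) (α : ℝ) (Y : Euc n → Euc n) (Φ : ℝ → Euc n → Euc n),
        ContDiff ℝ (⊤ : ℕ∞) χ → (∀ p, χ p ∈ Set.Icc (0 : ℝ) 1) →
        (∀ p : Euc n, ‖p‖ ≤ R₁ → χ p = 0) → (∀ p : Euc n, R₁ + 1 ≤ ‖p‖ → χ p = 1) →
        |α| ≤ M₀ → ContDiff ℝ (⊤ : ℕ∞) Y →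
        (∀ p : Euc n, (1 + ‖p‖) ^ 3 * ‖Y p - (α * χ p * (‖p‖ ^ 2)⁻¹) • p‖ ≤ C₀) →
        (∀ p : Euc n, (1 + ‖p‖) ^ 2 * (‖iteratedFDeriv ℝ 1 Y p‖ +
          ‖iteratedFDeriv ℝ 2 Y p‖ + ‖iteratedFDeriv ℝ 3 Y p‖) ≤ C₀) →
        ContDiffOn ℝ (⊤ : ℕ∞) (fun q : ℝ × Euc n => Φ q.1 q.2)
          (Set.Icc (0 : ℝ) T ×ˢ Set.univ) →
        (∀ t ∈ Set.Icc (0 : ℝ) T, ContDiff ℝ (⊤ : ℕ∞) (Φ t)) →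
        (∀ p, Φ 0 p = p) →
        (∀ p, ∀ t ∈ Set.Icc (0 : ℝ) T,
          HasDerivWithinAt (fun s => Φ s p) (Y (Φ t p)) (Set.Icc (0 : ℝ) T) t) →
        ∀ a ∈ Set.Icc (0 : ℝ) T, ∀ t ∈ Set.Icc (0 : ℝ) T, ∀ p : Euc n,
          flowWeight Φ t p =
            flowWeight Φ a p * (1 + ((t - a) / 2) * ⟪Φ a p, Y (Φ a p)⟫) +
              (t - a) ^ 2 * flowQ Y Φ a t p ∧
          |flowQ Y Φ a t p -
              (α ^ 2 / 4) * ∫ ρ in (0 : ℝ)..1,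
                Real.exp ((α / 2) * (a + (t - a) * ρ)) * (1 - ρ)| ≤
            C₂ * ((1 + ‖p‖) ^ 2)⁻¹ ∧
          ‖fderiv ℝ (fun q => flowQ Y Φ a t q) p‖ ≤ C₂ * (1 + ‖p‖)⁻¹ := by
  set B : ℝ := 2 * M₀ + C₀ with hBdef
  set A : ℝ := C₀ + M₀ * (R₁ + 2) ^ 2 with hAdef
  set D : ℝ := B * T + 1 with hD
  set k : ℝ := 1 + D with hk
  set b : ℝ := B * k with hb
  set L : ℝ := C₀ * k ^ 2 with hL
  have hB : 0 < B := by positivity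
  have hA : 0 < A := by positivity
  have hD0 : 0 < D := by positivity
  have hk0 : 0 < k := by positivity
  have hb0 : 0 < b := by positivity
  have hL0 : 0 < L := by positivity
  set K1 : ℝ := ((A * (B + M₀) + 2 * B ^ 2 + 2 * (C₀ * B)) * (1 + B * T) ^ 2 *
      Real.exp (B * T + M₀ * T)
      + M₀ ^ 2 * (Real.exp (B * T + M₀ * T) * (A * (1 + B * T) ^ 2 * T))) with hK1
  set K2 : ℝ := ((2 * B * (b + k * L) + 4 * b * L + 2 * (L * b + k * L * b + k * L ^ 2)) *
        Real.exp (C₀ * T) * Real.exp (B * T) +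
        AuxFlow.cH M₀ C₀ A B T *
          (Real.exp (B * T) * ((b + k * L) * Real.exp (C₀ * T) * T))) with hK2
  have hcH : 0 < AuxFlow.cH M₀ C₀ A B T := by unfold AuxFlow.cH; positivity
  have hK1p : 0 < K1 := by positivity
  have hK2p : 0 < K2 := by positivity
  refine ⟨K1 + K2, by positivity, ?_⟩
  intro χ α Y Φ _ hχ hχ0 hχ1 hα hY hY1 hY2 _ _ h0 hΦ a ha t ht p
  have hn1 : ∀ x, ‖iteratedFDeriv ℝ 1 Y x‖ = ‖fderiv ℝ Y x‖ := fun x => norm_iteratedFDeriv_one Y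
  have hn2 : ∀ x, ‖iteratedFDeriv ℝ 2 Y x‖ = ‖fderiv ℝ (fderiv ℝ Y) x‖ := fun x => by
    rw [← norm_iteratedFDeriv_one, norm_iteratedFDeriv_fderiv]
  have F : AuxFlow M₀ C₀ A B T α Y Φ :=
    { hC := hC₀, hB := hB, hT := hT, hα := hα
      hY := contDiff_infty.1 hY 2
      hYb := fun x => aux_Y_bound R₁ M₀ C₀ α (χ x) hR₁ hα hC₀ x (Y x) (hχ x) (hχ0 x) (hY1 x)
      hg := fun x => aux_g_bound R₁ M₀ C₀ α (χ x) hR₁ hα hC₀ x (Y x) (hχ x) (hχ0 x) (hχ1 x) (hY1 x)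
      hD1 := fun x => by
        refine le_trans ?_ (hY2 x)
        gcongr
        rw [hn1]
        linarith [norm_nonneg (iteratedFDeriv ℝ 2 Y x), norm_nonneg (iteratedFDeriv ℝ 3 Y x)]
      hD2 := fun x => by
        refine le_trans ?_ (hY2 x)
        gcongr
        rw [hn2]
        linarith [norm_nonneg (iteratedFDeriv ℝ 1 Y x), norm_nonneg (iteratedFDeriv ℝ 3 Y x)]
      h0 := h0, hΦ := hΦ }
  have hγ : ∀ ρ ∈ Set.Icc (0 : ℝ) 1, a + (t - a) * ρ ∈ Set.Icc (0 : ℝ) T := by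
    intro ρ hρ
    have := (convex_Icc (0 : ℝ) T) ha ht (sub_nonneg.2 hρ.2) hρ.1 (by ring)
    simp only [smul_eq_mul] at this
    convert this using 1
    ring
  have hQ : ∀ q, flowQ Y Φ a t q = (1 / 4) * ∫ ρ in (0 : ℝ)..1,
      AuxFlow.HH Y Φ (a + (t - a) * ρ) q *
        Real.exp (auxE Φ (a + (t - a) * ρ) q) * (1 - ρ) := fun q => rfl
  have hTay := fun q => F.taylor a t ha ht q hγ
  have hp := norm_nonneg p
  refine ⟨?_, ?_, ?_⟩
  · rw [hQ]; exact (hTay p).2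
  · rw [hQ]
    have i2 : IntervalIntegrable (fun ρ : ℝ => α ^ 2 *
        (Real.exp ((α / 2) * (a + (t - a) * ρ)) * (1 - ρ))) MeasureTheory.volume 0 1 :=
      Continuous.intervalIntegrable (by fun_prop) _ _
    have e : (1 / 4) * (∫ ρ in (0 : ℝ)..1, AuxFlow.HH Y Φ (a + (t - a) * ρ) p *
        Real.exp (auxE Φ (a + (t - a) * ρ) p) * (1 - ρ)) - (α ^ 2 / 4) * (∫ ρ in (0 : ℝ)..1,
                Real.exp ((α / 2) * (a + (t - a) * ρ)) * (1 - ρ)) =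
        (1 / 4) * ∫ ρ in (0 : ℝ)..1, (AuxFlow.HH Y Φ (a + (t - a) * ρ) p *
          Real.exp (auxE Φ (a + (t - a) * ρ) p) * (1 - ρ) -
          α ^ 2 * (Real.exp ((α / 2) * (a + (t - a) * ρ)) * (1 - ρ))) := by
      rw [intervalIntegral.integral_sub (hTay p).1 i2, intervalIntegral.integral_const_mul]
      ring
    rw [e, abs_mul, abs_of_pos (by norm_num : (0 : ℝ) < 1 / 4)]
    have hb := intervalIntegral.norm_integral_le_of_norm_le_const (a := (0 : ℝ)) (b := 1)
      (C := K1 * ((1 + ‖p‖)⁻¹) ^ 2) (f := fun ρ => (AuxFlow.HH Y Φ (a + (t - a) * ρ) p *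
          Real.exp (auxE Φ (a + (t - a) * ρ) p) * (1 - ρ) -
          α ^ 2 * (Real.exp ((α / 2) * (a + (t - a) * ρ)) * (1 - ρ)))) (by
        intro ρ hρ
        rw [Set.uIoc_of_le zero_le_one] at hρ
        have h1 := F.final_near p _ (hγ ρ ⟨hρ.1.le, hρ.2⟩)
        rw [← hK1] at h1
        rw [← mul_assoc, ← sub_mul, Real.norm_eq_abs, abs_mul,
          abs_of_nonneg (sub_nonneg.2 hρ.2)]
        refine le_trans ?_ h1
        exact mul_le_of_le_one_right (abs_nonneg _) (by linarith [hρ.1]))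
    rw [Real.norm_eq_abs] at hb
    have hz : 0 < ((1 + ‖p‖) ^ 2)⁻¹ := by positivity
    rw [inv_pow, sub_zero, abs_one, mul_one] at hb
    have z1 := mul_pos hK1p hz
    have z2 := mul_pos hK2p hz
    rw [add_mul]
    linarith
  · have hz : 0 < (1 + ‖p‖)⁻¹ := by positivity
    have : ‖fderiv ℝ (fun q => flowQ Y Φ a t q) p‖ ≤ K2 * (1 + ‖p‖)⁻¹ := by
      apply norm_fderiv_le_of_lip' ℝ (by positivity)
      filter_upwards [Metric.closedBall_mem_nhds p zero_lt_one] with q hq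
      have hq' : ‖q - p‖ ≤ 1 := by simpa [dist_eq_norm] using hq
      rw [hQ, hQ, ← mul_sub, ← intervalIntegral.integral_sub (hTay q).1 (hTay p).1]
      have hb := intervalIntegral.norm_integral_le_of_norm_le_const (a := (0 : ℝ)) (b := 1)
        (C := K2 * (1 + ‖p‖)⁻¹ * ‖q - p‖) (f := fun ρ => (AuxFlow.HH Y Φ (a + (t - a) * ρ) q *
          Real.exp (auxE Φ (a + (t - a) * ρ) q) * (1 - ρ) -
          AuxFlow.HH Y Φ (a + (t - a) * ρ) p *
          Real.exp (auxE Φ (a + (t - a) * ρ) p) * (1 - ρ))) (by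
        intro ρ hρ
        rw [Set.uIoc_of_le zero_le_one] at hρ
        have h1 := F.final_lip D b k L hD hk hb hL p q hq' _ (hγ ρ ⟨hρ.1.le, hρ.2⟩)
        rw [← hK2] at h1
        rw [← sub_mul, Real.norm_eq_abs, abs_mul,
          abs_of_nonneg (sub_nonneg.2 hρ.2)]
        refine le_trans ?_ h1
        exact mul_le_of_le_one_right (abs_nonneg _) (by linarith [hρ.1]))
      rw [sub_zero, abs_one, mul_one] at hb
      rw [norm_mul, Real.norm_eq_abs (1 / 4), abs_of_pos (by norm_num : (0 : ℝ) < 1 / 4)]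
      refine le_trans ?_ hb
      exact mul_le_of_le_one_left (norm_nonneg _) (by norm_num)
    refine this.trans ?_
    gcongr
    linarith
end
end
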